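/- arXiv:1908.10215 — 2 statements merged into one kernel-verified Lean document; each statement's English description precedes it below -/
import Mathlib

section
/- Fix an integer k ≥ 3 and let μ = E[X]. As n → ∞, the fifth central moment E[(X − μ)⁵] is asymptotically equivalent to 5 · (1/((k−3)!)⁵) · n^(5k−8) / 2^(5·C(k,2) − 5), i.e., the ratio of the two quantities tends to 1. -/
/-- An edge coloring of the complete graph on `Fin n`: each 2-element subset of
vertices (edge) is colored with one of two colors (`true` = red, `false` = blue). -/
abbrev EdgeColoring (n : ℕ) : Type := {e : Finset (Fin n) // e.card = 2} → Bool

/-- `X`: the number of `k`-element vertex subsets all of whose induced edges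
receive the same color (monochromatic `K_k`) in the coloring `c`. -/
def monoCount (n k : ℕ) (c : EdgeColoring n) : ℕ :=
  ((Finset.univ.powersetCard k).filter (fun S : Finset (Fin n) => ∃ b : Bool,
    ∀ e : {e : Finset (Fin n) // e.card = 2}, (e : Finset (Fin n)) ⊆ S → c e = b)).card

/-- Expectation of `f` under the uniform distribution on all edge colorings. -/
noncomputable def expec (n : ℕ) (f : EdgeColoring n → ℝ) : ℝ :=
  (∑ c : EdgeColoring n, f c) / (Fintype.card (EdgeColoring n) : ℝ)

/-- The `m`-th central moment of the number of monochromatic `K_k`'s in a uniformly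
random edge coloring of the complete graph on `n` vertices. -/
noncomputable def centralMoment (n k m : ℕ) : ℝ :=
  expec n (fun c => ((monoCount n k c : ℝ) -
    expec n (fun c' => (monoCount n k c' : ℝ))) ^ m)

namespace MonochromaticCliques

open Finset

variable {n : ℕ}

/-- The edges of the complete graph on `Fin n`. -/
abbrev Edge (n : ℕ) : Type := {e : Finset (Fin n) // e.card = 2}

/-- The vertices covered by a set of edges. -/
def vert (F : Finset (Edge n)) : Finset (Fin n) := F.biUnion fun e => e.1

/-- The edges with both endpoints in `S`. -/
def edgesIn (S : Finset (Fin n)) : Finset (Edge n) := univ.filter fun e => e.1 ⊆ S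

/-- The number of `k`-subsets of the vertex set whose induced edges include `F`. -/
def extCount (k : ℕ) (F : Finset (Edge n)) : ℕ :=
  ((univ.powersetCard k).filter fun S : Finset (Fin n) => vert F ⊆ S).card

/-- The sign attached to a color. -/
def sgn (b : Bool) : ℝ := if b then 1 else -1

/-- The Walsh character of an edge set. -/
noncomputable def chi (F : Finset (Edge n)) (c : EdgeColoring n) : ℝ := ∏ e ∈ F, sgn (c e)

lemma mem_vert {F : Finset (Edge n)} {x : Fin n} : x ∈ vert F ↔ ∃ e ∈ F, x ∈ e.1 := by
  simp [vert]

lemma subset_edgesIn_iff {F : Finset (Edge n)} {S : Finset (Fin n)} :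
    F ⊆ edgesIn S ↔ vert F ⊆ S := by
  simp only [vert, Finset.biUnion_subset, edgesIn]
  constructor
  · intro h e he
    exact (mem_filter.1 (h he)).2
  · intro h e he
    exact mem_filter.2 ⟨mem_univ _, h e he⟩

lemma card_edgesIn (S : Finset (Fin n)) : (edgesIn S).card = S.card.choose 2 := by
  rw [← Finset.card_powersetCard]
  refine Finset.card_bij (fun e _ => e.1) ?_ ?_ ?_
  · intro e he
    exact mem_powersetCard.2 ⟨(mem_filter.1 he).2, e.2⟩
  · intro a _ b _ h
    exact Subtype.ext h
  · intro b hb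
    obtain ⟨h1, h2⟩ := mem_powersetCard.1 hb
    exact ⟨⟨b, h2⟩, mem_filter.2 ⟨mem_univ _, h1⟩, rfl⟩

lemma prod_one_add_sgn (A : Finset (Edge n)) (c : EdgeColoring n) :
    ∏ e ∈ A, (1 + sgn (c e)) = if ∀ e ∈ A, c e = true then (2 : ℝ) ^ A.card else 0 := by
  split_ifs with h
  · rw [← Finset.prod_const]
    refine Finset.prod_congr rfl fun e he => ?_
    simp [sgn, h e he]; norm_num
  · push Not at h
    obtain ⟨e, he, hc⟩ := h
    exact Finset.prod_eq_zero he (by simp [sgn, hc])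

lemma prod_one_sub_sgn (A : Finset (Edge n)) (c : EdgeColoring n) :
    ∏ e ∈ A, (1 - sgn (c e)) = if ∀ e ∈ A, c e = false then (2 : ℝ) ^ A.card else 0 := by
  split_ifs with h
  · rw [← Finset.prod_const]
    refine Finset.prod_congr rfl fun e he => ?_
    simp [sgn, h e he]; norm_num
  · push Not at h
    obtain ⟨e, he, hc⟩ := h
    exact Finset.prod_eq_zero he (by simp [sgn, hc])

lemma two_mul_sum_even_chi (A : Finset (Edge n)) (c : EdgeColoring n) :
    2 * ∑ F ∈ A.powerset with Even F.card, chi F c =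
      ∏ e ∈ A, (1 + sgn (c e)) + ∏ e ∈ A, (1 - sgn (c e)) := by
  have h2 : ∏ e ∈ A, (1 - sgn (c e)) = ∑ F ∈ A.powerset, (-1) ^ F.card * chi F c := by
    simp only [sub_eq_add_neg, Finset.prod_one_add, Finset.prod_neg, chi]
  rw [h2, Finset.prod_one_add, ← Finset.sum_add_distrib, Finset.sum_filter, Finset.mul_sum]
  refine Finset.sum_congr rfl fun F _ => ?_
  split_ifs with h
  · simp only [h.neg_one_pow, chi]; ring
  · simp only [(Nat.not_even_iff_odd.1 h).neg_one_pow, chi]; ring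

lemma monochromatic_indicator (A : Finset (Edge n)) (hA : A.Nonempty) (c : EdgeColoring n) :
    (if ∃ b : Bool, ∀ e ∈ A, c e = b then (1 : ℝ) else 0) =
      2 / 2 ^ A.card * ∑ F ∈ A.powerset with Even F.card, chi F c := by
  have h := two_mul_sum_even_chi A c
  rw [prod_one_add_sgn, prod_one_sub_sgn] at h
  rw [div_mul_eq_mul_div, h, eq_div_iff (by positivity)]
  obtain ⟨a, ha⟩ := hA
  rcases hb : c a with _ | _
  · have h1 : ¬ ∀ e ∈ A, c e = true := fun h => by simp [h a ha] at hb
    have h3 : (∃ b : Bool, ∀ e ∈ A, c e = b) ↔ ∀ e ∈ A, c e = false :=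
      ⟨fun ⟨b, h⟩ => by rwa [← hb, h a ha], fun h => ⟨_, h⟩⟩
    simp only [h1, h3, if_false, zero_add, ite_mul, one_mul, zero_mul]
  · have h1 : ¬ ∀ e ∈ A, c e = false := fun h => by simp [h a ha] at hb
    have h3 : (∃ b : Bool, ∀ e ∈ A, c e = b) ↔ ∀ e ∈ A, c e = true :=
      ⟨fun ⟨b, h⟩ => by rwa [← hb, h a ha], fun h => ⟨_, h⟩⟩
    simp only [h1, h3, if_false, add_zero, ite_mul, one_mul, zero_mul]

/-- Walsh expansion of the number of monochromatic cliques. -/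
lemma monoCount_eq_sum_chi {k : ℕ} (hk : 2 ≤ k) (c : EdgeColoring n) :
    (monoCount n k c : ℝ) = 2 / 2 ^ k.choose 2 *
      ∑ F : Finset (Edge n) with Even F.card, (extCount k F : ℝ) * chi F c := by
  have h : ∀ S ∈ (univ : Finset (Fin n)).powersetCard k,
      (if ∃ b : Bool, ∀ e : Edge n, e.1 ⊆ S → c e = b then (1 : ℝ) else 0) =
      2 / 2 ^ k.choose 2 * ∑ F : Finset (Edge n) with Even F.card,
        if vert F ⊆ S then chi F c else 0 := by
    intro S hS
    have hS := (mem_powersetCard.1 hS).2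
    have hA : (edgesIn S).Nonempty := by
      rw [← Finset.card_pos, card_edgesIn, hS]
      exact Nat.choose_pos hk
    have := monochromatic_indicator _ hA c
    rw [card_edgesIn, hS] at this
    simp only [edgesIn, mem_filter, mem_univ, true_and] at this
    rw [this, ← Finset.sum_filter]
    congr 2
    ext F
    rw [mem_filter, mem_filter, mem_filter, mem_powerset, ← subset_edgesIn_iff, edgesIn]
    simp [and_comm]
  rw [monoCount, Finset.card_filter]
  push_cast
  rw [Finset.sum_congr rfl h, ← Finset.mul_sum, Finset.sum_comm]
  congr 1
  refine Finset.sum_congr rfl fun F _ => ?_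
  rw [← Finset.sum_filter, Finset.sum_const, extCount, nsmul_eq_mul]

lemma expec_prod_chi {ι : Type*} [Fintype ι] (F : ι → Finset (Edge n)) :
    expec n (fun c => ∏ i, chi (F i) c) =
      if ∀ e, Even (univ.filter fun i => e ∈ F i).card then 1 else 0 := by
  classical
  have h : ∀ c : EdgeColoring n, ∏ i, chi (F i) c =
      ∏ e, sgn (c e) ^ (univ.filter fun i => e ∈ F i).card := by
    intro c
    simp only [chi]
    have : ∀ i, ∏ e ∈ F i, sgn (c e) = ∏ e, if e ∈ F i then sgn (c e) else 1 := fun i => by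
      rw [Finset.prod_ite_mem, Finset.univ_inter]
    simp only [this]
    rw [Finset.prod_comm]
    refine Finset.prod_congr rfl fun e _ => ?_
    rw [← Finset.prod_filter, Finset.prod_const]
  have h2 : ∑ c : EdgeColoring n, ∏ i, chi (F i) c =
      ∏ e : Edge n, ∑ b : Bool, sgn b ^ (univ.filter fun i => e ∈ F i).card := by
    rw [Finset.prod_univ_sum, Fintype.piFinset_univ]
    exact Finset.sum_congr rfl fun c _ => h c
  rw [expec, h2]
  split_ifs with h3
  · have : ∀ e : Edge n, ∑ b : Bool, sgn b ^ (univ.filter fun i => e ∈ F i).card = 2 := by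
      intro e
      rw [Fintype.sum_bool]
      simp only [sgn, if_true, Bool.false_eq_true, if_false, (h3 e).neg_one_pow, one_pow]
      norm_num
    rw [Finset.prod_congr rfl fun e _ => this e, Fintype.card_fun, Fintype.card_bool,
      Finset.prod_const, Finset.card_univ]
    push_cast
    exact div_self (by positivity)
  · push Not at h3
    obtain ⟨e, he⟩ := h3
    rw [Finset.prod_eq_zero (mem_univ e), zero_div]
    simp [sgn, (Nat.not_even_iff_odd.1 he).neg_one_pow]

lemma expec_const_mul (a : ℝ) (f : EdgeColoring n → ℝ) :
    expec n (fun c => a * f c) = a * expec n f := by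
  simp only [expec, ← Finset.mul_sum, mul_div_assoc]

lemma expec_sum {ι : Type*} (s : Finset ι) (f : ι → EdgeColoring n → ℝ) :
    expec n (fun c => ∑ i ∈ s, f i c) = ∑ i ∈ s, expec n (f i) := by
  simp only [expec]
  rw [Finset.sum_comm, Finset.sum_div]

lemma expec_chi (F : Finset (Edge n)) : expec n (chi F) = if F = ∅ then 1 else 0 := by
  have h := expec_prod_chi (fun _ : Unit => F)
  simp only [Finset.univ_unique, Finset.prod_singleton] at h
  rw [show (chi F) = fun c => chi F c from rfl, h]
  congr 1
  rw [eq_iff_iff, Finset.eq_empty_iff_forall_notMem]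
  refine forall_congr' fun e => ?_
  by_cases he : e ∈ F <;> simp [he, Finset.filter_singleton]

/-- Families of nonempty edge sets of even size in which every edge occurs an even number of
times. -/
def evenFamilies (n m : ℕ) : Finset (Fin m → Finset (Edge n)) :=
  univ.filter fun F => (∀ i, (F i).Nonempty ∧ Even (F i).card) ∧
    ∀ e, Even (univ.filter fun i => e ∈ F i).card

lemma monoCount_sub_expec {k : ℕ} (hk : 2 ≤ k) (c : EdgeColoring n) :
    (monoCount n k c : ℝ) - expec n (fun c' => (monoCount n k c' : ℝ)) =
      2 / 2 ^ k.choose 2 * ∑ F : Finset (Edge n) with F.Nonempty ∧ Even F.card,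
        (extCount k F : ℝ) * chi F c := by
  simp only [monoCount_eq_sum_chi hk]
  rw [expec_const_mul, expec_sum, ← mul_sub, ← Finset.sum_sub_distrib, Finset.sum_filter,
    Finset.sum_filter]
  congr 1
  refine Finset.sum_congr rfl fun F _ => ?_
  rw [expec_const_mul, show expec n (fun c => chi F c) = _ from expec_chi F]
  rcases F.eq_empty_or_nonempty with rfl | h
  · simp [chi]
  · simp [h, h.ne_empty]

theorem centralMoment_eq_sum {k : ℕ} (hk : 2 ≤ k) (m : ℕ) :
    centralMoment n k m = (2 / 2 ^ k.choose 2) ^ m *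
      ∑ F ∈ evenFamilies n m, ∏ i, (extCount k (F i) : ℝ) := by
  simp only [centralMoment, monoCount_sub_expec hk, mul_pow]
  rw [expec_const_mul]
  congr 1
  simp only [Finset.sum_pow', Finset.prod_mul_distrib]
  rw [expec_sum]
  simp only [expec_const_mul, expec_prod_chi, mul_ite, mul_one, mul_zero]
  rw [← Finset.sum_filter]
  refine Finset.sum_congr ?_ fun _ _ => rfl
  ext F
  simp [evenFamilies]

/-- The edges joining `c` to the vertices of `s`. -/
def cherry (c : Fin n) (s : Finset (Fin n)) : Finset (Edge n) :=
  univ.filter fun e => ∃ x ∈ s, e.1 = {c, x}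

lemma mem_cherry {c : Fin n} {s : Finset (Fin n)} {e : Edge n} :
    e ∈ cherry c s ↔ ∃ x ∈ s, e.1 = {c, x} := by
  simp [cherry]

lemma card_cherry {c : Fin n} {s : Finset (Fin n)} (hc : c ∉ s) : (cherry c s).card = s.card := by
  symm
  refine Finset.card_bij
    (fun x hx => ⟨{c, x}, Finset.card_pair fun h => hc (h ▸ hx)⟩) ?_ ?_ ?_
  · intro x hx
    exact mem_cherry.2 ⟨x, hx, rfl⟩
  · intro x hx y hy h
    have hxy : ({c, x} : Finset (Fin n)) = {c, y} := congrArg Subtype.val h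
    have : x ∈ ({c, y} : Finset (Fin n)) := hxy ▸ by simp
    rcases Finset.mem_insert.1 this with rfl | h
    · exact absurd hx hc
    · exact Finset.mem_singleton.1 h
  · intro e he
    obtain ⟨x, hx, h⟩ := mem_cherry.1 he
    exact ⟨x, hx, Subtype.ext h.symm⟩

lemma vert_cherry {c : Fin n} {s : Finset (Fin n)} (hc : c ∉ s) (hs : s.Nonempty) :
    vert (cherry c s) = insert c s := by
  ext x
  simp only [mem_vert, mem_cherry, Finset.mem_insert]
  constructor
  · rintro ⟨e, ⟨y, hy, he⟩, hx⟩
    rw [he, Finset.mem_insert, Finset.mem_singleton] at hx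
    rcases hx with rfl | rfl
    · exact Or.inl rfl
    · exact Or.inr hy
  · have key : ∀ y ∈ s, ∃ e : Edge n, e.1 = {c, y} := fun y hy =>
      ⟨⟨{c, y}, Finset.card_pair fun h => hc (h ▸ hy)⟩, rfl⟩
    rintro (rfl | hx)
    · obtain ⟨y, hy⟩ := hs
      obtain ⟨e, he⟩ := key y hy
      exact ⟨e, ⟨y, hy, he⟩, by simp [he]⟩
    · obtain ⟨e, he⟩ := key x hx
      exact ⟨e, ⟨x, hx, he⟩, by simp [he]⟩

lemma cherry_inj {c d : Fin n} {s t : Finset (Fin n)} (hc : c ∉ s) (hd : d ∉ t)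
    (hs : 2 ≤ s.card) (ht : 2 ≤ t.card) (h : cherry c s = cherry d t) : c = d ∧ s = t := by
  have hcd : c = d := by
    by_contra hne
    have : ∀ x ∈ s, x = d := by
      intro x hx
      have he : (⟨{c, x}, Finset.card_pair fun h => hc (h ▸ hx)⟩ : Edge n) ∈ cherry d t :=
        h ▸ mem_cherry.2 ⟨x, hx, rfl⟩
      obtain ⟨y, _, hy⟩ := mem_cherry.1 he
      have : d ∈ ({c, x} : Finset (Fin n)) := by
        change ({c, x} : Finset (Fin n)) = {d, y} at hy
        simp [hy]
      rcases Finset.mem_insert.1 this with h | h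
      · exact absurd h.symm hne
      · exact (Finset.mem_singleton.1 h).symm
    have := Finset.card_le_card (fun x hx => Finset.mem_singleton.2 (this x hx) : s ⊆ {d})
    simp at this
    omega
  subst hcd
  refine ⟨rfl, ?_⟩
  have h' := congrArg vert h
  rw [vert_cherry hc (Finset.card_pos.1 (by omega)),
    vert_cherry hd (Finset.card_pos.1 (by omega))] at h'
  rw [← Finset.erase_insert hc, h', Finset.erase_insert hd]

lemma exists_two_edges {F : Finset (Edge n)} (hne : F.Nonempty) (hev : Even F.card) :
    ∃ e ∈ F, ∃ f ∈ F, e ≠ f ∧ e.1 ∪ f.1 ⊆ vert F ∧ 3 ≤ (e.1 ∪ f.1).card := by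
  have h1 : 1 < F.card := by
    have := hne.card_pos
    obtain ⟨m, hm⟩ := hev
    omega
  obtain ⟨e, he, f, hf, hef⟩ := Finset.one_lt_card.1 h1
  refine ⟨e, he, f, hf, hef, ?_, ?_⟩
  · exact Finset.union_subset (Finset.subset_biUnion_of_mem (fun e : Edge n => e.1) he)
      (Finset.subset_biUnion_of_mem (fun e : Edge n => e.1) hf)
  · have hlt : e.1 ⊂ e.1 ∪ f.1 := by
      refine Finset.ssubset_iff_subset_ne.2 ⟨Finset.subset_union_left, fun h => hef ?_⟩
      have hfe : f.1 ⊆ e.1 := h ▸ Finset.subset_union_right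
      exact Subtype.ext (Finset.eq_of_subset_of_card_le hfe (by rw [e.2, f.2])).symm
    have := Finset.card_lt_card hlt
    rw [e.2] at this
    omega

lemma three_le_card_vert {F : Finset (Edge n)} (hne : F.Nonempty) (hev : Even F.card) :
    3 ≤ (vert F).card := by
  obtain ⟨e, _, f, _, _, hsub, h3⟩ := exists_two_edges hne hev
  exact h3.trans (Finset.card_le_card hsub)

lemma exists_eq_cherry {F : Finset (Edge n)} (hne : F.Nonempty) (hev : Even F.card)
    (hv : (vert F).card = 3) : ∃ c s, c ∉ s ∧ s.card = 2 ∧ F = cherry c s := by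
  obtain ⟨e, he, f, hf, hef, hsub, h3⟩ := exists_two_edges hne hev
  have hU : e.1 ∪ f.1 = vert F := Finset.eq_of_subset_of_card_le hsub (by omega)
  have hF3 : F.card ≤ 3 := by
    have := Finset.card_le_card (subset_edgesIn_iff.2 (le_refl (vert F)))
    rw [card_edgesIn, hv] at this
    exact this
  have hF : {e, f} = F := by
    refine Finset.eq_of_subset_of_card_le ?_ ?_
    · simp [Finset.insert_subset_iff, he, hf]
    · rw [Finset.card_pair hef]
      obtain ⟨m, hm⟩ := hev
      omega
  have hI : (e.1 ∩ f.1).card = 1 := by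
    have := Finset.card_union_add_card_inter e.1 f.1
    rw [hU, hv, e.2, f.2] at this
    omega
  obtain ⟨c, hc⟩ := Finset.card_eq_one.1 hI
  have hce : c ∈ e.1 ∩ f.1 := hc ▸ Finset.mem_singleton_self c
  have hcV : c ∈ vert F := hU ▸ Finset.mem_union_left _ (Finset.mem_inter.1 hce).1
  have hs : ((vert F).erase c).card = 2 := by rw [Finset.card_erase_of_mem hcV, hv]
  refine ⟨c, (vert F).erase c, Finset.notMem_erase _ _, hs, ?_⟩
  refine Finset.eq_of_subset_of_card_le ?_ ?_
  · intro g hg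
    have hcg : c ∈ g.1 := by
      rw [← hF, Finset.mem_insert, Finset.mem_singleton] at hg
      rcases hg with rfl | rfl
      · exact (Finset.mem_inter.1 hce).1
      · exact (Finset.mem_inter.1 hce).2
    have h1 : (g.1.erase c).card = 1 := by rw [Finset.card_erase_of_mem hcg, g.2]
    obtain ⟨x, hx⟩ := Finset.card_eq_one.1 h1
    have hxg : x ∈ g.1.erase c := hx ▸ Finset.mem_singleton_self x
    refine mem_cherry.2 ⟨x, ?_, ?_⟩
    · exact Finset.mem_erase.2 ⟨(Finset.mem_erase.1 hxg).1,
        mem_vert.2 ⟨g, hg, (Finset.mem_erase.1 hxg).2⟩⟩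
    · rw [← hx, Finset.insert_erase hcg]
  · rw [card_cherry (Finset.notMem_erase _ _), hs, ← hF, Finset.card_pair hef]

section Degrees

variable {ι : Type*} [Fintype ι] {F : ι → Finset (Edge n)}

/-- The vertices covered by a family of edge sets. -/
def support (F : ι → Finset (Edge n)) : Finset (Fin n) := univ.biUnion fun i => vert (F i)

/-- The number of members of a family of edge sets that cover the vertex `x`. -/
def deg (F : ι → Finset (Edge n)) (x : Fin n) : ℕ := (univ.filter fun i => x ∈ vert (F i)).card

lemma mem_support {x : Fin n} : x ∈ support F ↔ ∃ i, x ∈ vert (F i) := by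
  simp [support]

lemma sum_card_vert : ∑ i, (vert (F i)).card = ∑ x ∈ support F, deg F x := by
  simp only [deg, Finset.card_filter]
  rw [Finset.sum_comm]
  refine Finset.sum_congr rfl fun i _ => ?_
  rw [← Finset.card_filter]
  congr 1
  ext x
  simp only [mem_filter, mem_support]
  exact ⟨fun h => ⟨⟨i, h⟩, h⟩, fun h => h.2⟩

lemma two_le_card_of_even (hpar : ∀ e, Even (univ.filter fun i => e ∈ F i).card)
    {e : Edge n} {i : ι} (he : e ∈ F i) : 2 ≤ (univ.filter fun i => e ∈ F i).card := by
  have : 0 < (univ.filter fun i => e ∈ F i).card :=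
    Finset.card_pos.2 ⟨i, mem_filter.2 ⟨mem_univ _, he⟩⟩
  obtain ⟨m, hm⟩ := hpar e
  omega

lemma filter_edge_subset {e : Edge n} {x : Fin n} (hx : x ∈ e.1) :
    (univ.filter fun i => e ∈ F i) ⊆ univ.filter fun i => x ∈ vert (F i) :=
  Finset.monotone_filter_right _ fun _ _ h => mem_vert.2 ⟨e, h, hx⟩

lemma two_le_deg (hpar : ∀ e, Even (univ.filter fun i => e ∈ F i).card)
    {x : Fin n} (hx : x ∈ support F) : 2 ≤ deg F x := by
  obtain ⟨i, hi⟩ := mem_support.1 hx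
  obtain ⟨e, he, hxe⟩ := mem_vert.1 hi
  exact (two_le_card_of_even hpar he).trans (Finset.card_le_card (filter_edge_subset hxe))

lemma mem_of_deg_eq_two (hpar : ∀ e, Even (univ.filter fun i => e ∈ F i).card)
    {x : Fin n} (hx : deg F x = 2) {e : Edge n} {i j : ι} (he : e ∈ F i) (hxe : x ∈ e.1)
    (hj : x ∈ vert (F j)) : e ∈ F j := by
  have h := Finset.eq_of_subset_of_card_le (filter_edge_subset (F := F) hxe)
    (hx.le.trans (two_le_card_of_even hpar he))
  have : j ∈ univ.filter fun i => e ∈ F i := h ▸ mem_filter.2 ⟨mem_univ _, hj⟩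
  exact (mem_filter.1 this).2

lemma exists_superset_of_deg_center (hpar : ∀ e, Even (univ.filter fun i => e ∈ F i).card)
    {i : ι} {c : Fin n} {s : Finset (Fin n)} (hi : F i = cherry c s) (hc : c ∉ s)
    (hs : s.Nonempty) (hd : deg F c = 2) : ∃ j ≠ i, F i ⊆ F j := by
  have hci : c ∈ vert (F i) := by rw [hi, vert_cherry hc hs]; exact Finset.mem_insert_self _ _
  have h2 : 1 < (univ.filter fun i => c ∈ vert (F i)).card := by
    change 1 < deg F c
    omega
  obtain ⟨j, hj, hji⟩ := Finset.exists_mem_ne h2 i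
  refine ⟨j, hji, fun e he => ?_⟩
  refine mem_of_deg_eq_two hpar hd he ?_ (mem_filter.1 hj).2
  rw [hi] at he
  obtain ⟨x, _, hx⟩ := mem_cherry.1 he
  simp [hx]

end Degrees

lemma exists_unique_excess {α : Type*} [DecidableEq α] {s : Finset α} {f : α → ℕ} {m : ℕ}
    (h : ∀ x ∈ s, m ≤ f x) (hs : ∑ x ∈ s, f x = s.card * m + 1) :
    ∃ a ∈ s, f a = m + 1 ∧ ∀ x ∈ s, x ≠ a → f x = m := by
  have hex : ∃ a ∈ s, m < f a := by
    by_contra! hcon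
    have := Finset.sum_le_card_nsmul s f m hcon
    rw [smul_eq_mul, hs] at this
    omega
  obtain ⟨a, ha, hlt⟩ := hex
  have hsum := Finset.add_sum_erase s f ha
  have hcard := Finset.card_erase_add_one ha
  have hge : (s.erase a).card * m ≤ ∑ x ∈ s.erase a, f x :=
    Finset.card_nsmul_le_sum (s.erase a) f m fun x hx => h x (Finset.mem_of_mem_erase hx)
  have hm : s.card * m = (s.erase a).card * m + m := by rw [← hcard]; ring
  have hfa : f a = m + 1 := by omega
  refine ⟨a, ha, hfa, fun x hx hxa => ?_⟩
  have heq : ∑ x ∈ s.erase a, m = ∑ x ∈ s.erase a, f x := by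
    rw [Finset.sum_const, smul_eq_mul]; omega
  exact ((Finset.sum_eq_sum_iff_of_le fun x hx => h x (Finset.mem_of_mem_erase hx)).1 heq x
    (Finset.mem_erase.2 ⟨hxa, hx⟩)).symm

lemma false_of_deg_two_of_one_large {ι : Type*} [Fintype ι] [DecidableEq ι]
    {F : ι → Finset (Edge n)}
    (hne : ∀ i, (F i).Nonempty ∧ Even (F i).card)
    (hpar : ∀ e, Even (univ.filter fun i => e ∈ F i).card)
    (hdeg : ∀ x ∈ support F, deg F x = 2) {a : ι} (ha : (vert (F a)).card = 4)
    (hv : ∀ i, i ≠ a → (vert (F i)).card = 3) : False := by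
  have hsum : ∑ i ∈ univ.erase a, (vert (F a) ∩ vert (F i)).card = 4 := by
    have h1 : ∀ i, (vert (F a) ∩ vert (F i)).card =
        ∑ x ∈ vert (F a), if x ∈ vert (F i) then 1 else 0 := fun i => by
      rw [← Finset.card_filter, Finset.filter_mem_eq_inter]
    simp only [h1]
    rw [Finset.sum_comm, ← ha, Finset.card_eq_sum_ones]
    refine Finset.sum_congr rfl fun x hx => ?_
    have hmem : a ∈ univ.filter fun i => x ∈ vert (F i) := mem_filter.2 ⟨mem_univ _, hx⟩
    rw [← Finset.card_filter, Finset.filter_erase, Finset.card_erase_of_mem hmem]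
    have := hdeg x (mem_support.2 ⟨a, hx⟩)
    rw [deg] at this
    rw [this]
  have hdvd : 3 ∣ ∑ i ∈ univ.erase a, (vert (F a) ∩ vert (F i)).card := by
    refine Finset.dvd_sum fun i hi => ?_
    have hia := (Finset.mem_erase.1 hi).1
    obtain ⟨c, s, hc, hs, hF⟩ := exists_eq_cherry (hne i).1 (hne i).2 (hv i hia)
    have hsne : s.Nonempty := Finset.card_pos.1 (by omega)
    have hci : c ∈ vert (F i) := by
      rw [hF, vert_cherry hc hsne]; exact Finset.mem_insert_self _ _
    obtain ⟨j, hji, hij⟩ := exists_superset_of_deg_center hpar hF hc hsne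
      (hdeg c (mem_support.2 ⟨i, hci⟩))
    have hVij : vert (F i) ⊆ vert (F j) := Finset.biUnion_subset_biUnion_of_subset_left _ hij
    by_cases hja : j = a
    · subst hja
      rw [Finset.inter_eq_right.2 hVij, hv i hia]
    · have : vert (F a) ∩ vert (F i) = ∅ := by
        rw [Finset.eq_empty_iff_forall_notMem]
        intro x hx
        obtain ⟨hxa, hxi⟩ := Finset.mem_inter.1 hx
        have hd := hdeg x (mem_support.2 ⟨a, hxa⟩)
        have hsub : ({i, j, a} : Finset ι) ⊆ univ.filter fun i => x ∈ vert (F i) := by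
          intro l hl
          simp only [Finset.mem_insert, Finset.mem_singleton] at hl
          rcases hl with rfl | rfl | rfl
          · simpa using hxi
          · simpa using hVij hxi
          · simpa using hxa
        have := Finset.card_le_card hsub
        rw [Finset.card_eq_three.2 ⟨i, j, a, hji.symm, hia, hja, rfl⟩] at this
        rw [deg] at hd
        omega
      simp [this]
  rw [hsum] at hdvd
  omega

lemma pair_mem_cherry {c y : Fin n} {s : Finset (Fin n)} (h : ({c, y} : Finset (Fin n)).card = 2) :
    (⟨{c, y}, h⟩ : Edge n) ∈ cherry c s ↔ y ∈ s := by
  rw [mem_cherry]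
  refine ⟨fun ⟨z, hz, hyz⟩ => ?_, fun hy => ⟨y, hy, rfl⟩⟩
  change ({c, y} : Finset (Fin n)) = {c, z} at hyz
  have hy : y ∈ ({c, z} : Finset (Fin n)) := hyz ▸ by simp
  rcases Finset.mem_insert.1 hy with rfl | hy
  · simp at h
  · rwa [Finset.mem_singleton.1 hy]

/-- The extremal families: the members indexed by `I` are the pairs of edges of a star with three
leaves, and the remaining members equal one common cherry. -/
def config (I : Finset (Fin 5)) (φ : Fin 5 ⊕ Bool ↪ Fin n) (i : Fin 5) : Finset (Edge n) :=
  if i ∈ I then cherry (φ (Sum.inr true)) ((I.erase i).image fun j => φ (Sum.inl j))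
  else cherry (φ (Sum.inr false)) (Iᶜ.image fun j => φ (Sum.inl j))

lemma exists_config {F : Fin 5 → Finset (Edge n)}
    (hne : ∀ i, (F i).Nonempty ∧ Even (F i).card)
    (hpar : ∀ e, Even (univ.filter fun i => e ∈ F i).card)
    (hS : (support F).card = 7) (hv : ∀ i, (vert (F i)).card = 3) :
    ∃ I φ, I.card = 3 ∧ F = config I φ := by
  choose c s hc hs hF using fun i => exists_eq_cherry (hne i).1 (hne i).2 (hv i)
  have hsne : ∀ i, (s i).Nonempty := fun i => Finset.card_pos.1 (by rw [hs]; norm_num)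
  have hvert : ∀ i, vert (F i) = insert (c i) (s i) := fun i => by
    conv_lhs => rw [hF i]
    exact vert_cherry (hc i) (hsne i)
  have hcv : ∀ i, c i ∈ vert (F i) := fun i => by rw [hvert]; exact Finset.mem_insert_self _ _
  have hcard : ∀ i, (F i).card = 2 := fun i => by rw [hF i, card_cherry (hc i), hs]
  have hsum : ∑ x ∈ support F, deg F x = (support F).card * 2 + 1 := by
    rw [← sum_card_vert, hS]
    simp [hv]
  obtain ⟨x₀, hx₀, hd3, hd2⟩ := exists_unique_excess (fun x hx => two_le_deg hpar hx) hsum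
  set I := univ.filter fun i => x₀ ∈ vert (F i) with hIdef
  have hI : I.card = 3 := hd3
  have hmemI : ∀ i, i ∈ I ↔ x₀ ∈ vert (F i) := fun i => by simp [hIdef]
  have hsame : ∀ i, c i ≠ x₀ → ∃ j ≠ i, F j = F i := fun i hi => by
    obtain ⟨j, hj, hij⟩ := exists_superset_of_deg_center hpar (hF i) (hc i) (hsne i)
      (hd2 _ (mem_support.2 ⟨i, hcv i⟩) hi)
    exact ⟨j, hj, (Finset.eq_of_subset_of_card_le hij (by rw [hcard, hcard])).symm⟩
  have hIc : Iᶜ.card = 2 := by rw [Finset.card_compl, hI, Fintype.card_fin]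
  obtain ⟨a, b, hab, hIab⟩ := Finset.card_eq_two.1 hIc
  have haI : a ∉ I := by rw [← Finset.mem_compl, hIab]; simp
  have hFab : F b = F a := by
    obtain ⟨j, hja, hj⟩ := hsame a fun h => haI ((hmemI a).2 (h ▸ hcv a))
    have : j ∈ Iᶜ := by rwa [Finset.mem_compl, hmemI, hj, ← hmemI]
    rw [hIab, Finset.mem_insert, Finset.mem_singleton] at this
    rcases this with h | rfl
    · exact absurd h hja
    · exact hj
  have hnotI : ∀ i, i ∉ I → F i = F a := fun i hi => by
    rw [← Finset.mem_compl, hIab, Finset.mem_insert, Finset.mem_singleton] at hi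
    rcases hi with rfl | rfl
    · rfl
    · exact hFab
  have hedge : ∀ (e : Edge n) (i : Fin 5), x₀ ∈ e.1 → e ∈ F i →
      (univ.filter fun i => e ∈ F i) ⊆ I ∧ (univ.filter fun i => e ∈ F i).card = 2 := by
    intro e i hx he
    have hsub : (univ.filter fun i => e ∈ F i) ⊆ I := filter_edge_subset hx
    refine ⟨hsub, ?_⟩
    have h2 := two_le_card_of_even hpar he
    have h3 := Finset.card_le_card hsub
    obtain ⟨m, hm⟩ := hpar e
    omega
  have herase : ∀ i ∈ I, ∀ j ∈ I, j ≠ i → ((I.erase i).erase j).card = 1 := fun i hi j hj hji => by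
    rw [Finset.card_erase_of_mem (Finset.mem_erase.2 ⟨hji, hj⟩), Finset.card_erase_of_mem hi, hI]
  have hcenter : ∀ i ∈ I, c i = x₀ := by
    intro i hi
    by_contra hci
    obtain ⟨j, hji, hj⟩ := hsame i hci
    have hjI : j ∈ I := by rwa [hmemI, hj, ← hmemI]
    obtain ⟨l, hl⟩ := Finset.card_pos.1 (by rw [herase i hi j hjI hji]; norm_num :
      0 < ((I.erase i).erase j).card)
    have hlj := (Finset.mem_erase.1 hl).1
    have hli := (Finset.mem_erase.1 (Finset.mem_erase.1 hl).2).1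
    have hlI := (Finset.mem_erase.1 (Finset.mem_erase.1 hl).2).2
    obtain ⟨e, he, hxe⟩ := mem_vert.1 ((hmemI l).1 hlI)
    obtain ⟨hsub, h2⟩ := hedge e l hxe he
    by_cases hei : e ∈ F i
    · have hsub' : ({i, j, l} : Finset (Fin 5)) ⊆ univ.filter fun i => e ∈ F i := by
        intro t ht
        simp only [Finset.mem_insert, Finset.mem_singleton] at ht
        rcases ht with rfl | rfl | rfl
        · simpa using hei
        · simpa [hj] using hei
        · simpa using he
      have := Finset.card_le_card hsub'
      rw [Finset.card_eq_three.2 ⟨i, j, l, hji.symm, hli.symm, hlj.symm, rfl⟩] at this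
      omega
    · have hsub' : (univ.filter fun i => e ∈ F i) ⊆ (I.erase i).erase j := by
        intro t ht
        have hte := (mem_filter.1 ht).2
        refine Finset.mem_erase.2 ⟨?_, Finset.mem_erase.2 ⟨?_, hsub ht⟩⟩
        · rintro rfl
          exact hei (hj ▸ hte)
        · rintro rfl
          exact hei hte
      have := Finset.card_le_card hsub'
      rw [herase i hi j hjI hji] at this
      omega
  have hFI : ∀ i ∈ I, F i = cherry x₀ (s i) := fun i hi => by rw [← hcenter i hi, ← hF]
  set L := I.biUnion s with hL
  have hx₀L : ∀ y ∈ L, x₀ ≠ y := by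
    rintro y hy rfl
    obtain ⟨i, hi, hyi⟩ := Finset.mem_biUnion.1 hy
    exact hc i (hcenter i hi ▸ hyi)
  have htwo : ∀ y ∈ L, (I.filter fun i => y ∈ s i).card = 2 := by
    intro y hy
    have hp : ({x₀, y} : Finset (Fin n)).card = 2 := Finset.card_pair (hx₀L y hy)
    obtain ⟨i, hi, hyi⟩ := Finset.mem_biUnion.1 hy
    have hei : (⟨{x₀, y}, hp⟩ : Edge n) ∈ F i := by
      rw [hFI i hi]; exact (pair_mem_cherry hp).2 hyi
    obtain ⟨hsub, h2⟩ := hedge _ i (by simp) hei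
    rw [← h2]
    congr 1
    ext t
    simp only [mem_filter, mem_univ, true_and]
    constructor
    · rintro ⟨ht, hyt⟩
      rw [hFI t ht]; exact (pair_mem_cherry hp).2 hyt
    · intro ht
      have htI : t ∈ I := hsub (mem_filter.2 ⟨mem_univ _, ht⟩)
      rw [hFI t htI] at ht
      exact ⟨htI, (pair_mem_cherry hp).1 ht⟩
  have hsL : ∀ i ∈ I, s i ⊆ L := fun i hi => Finset.subset_biUnion_of_mem s hi
  have hLcard : L.card = 3 := by
    have h1 : ∑ y ∈ L, (I.filter fun i => y ∈ s i).card = ∑ i ∈ I, (s i).card := by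
      simp only [Finset.card_filter]
      rw [Finset.sum_comm]
      refine Finset.sum_congr rfl fun i hi => ?_
      rw [← Finset.card_filter, Finset.filter_mem_eq_inter, Finset.inter_eq_right.2 (hsL i hi)]
    rw [Finset.sum_congr rfl htwo] at h1
    simp only [hs, Finset.sum_const, hI, smul_eq_mul] at h1
    omega
  have hmiss : ∀ i, ∃ y, i ∈ I → L \ s i = {y} := by
    intro i
    by_cases hi : i ∈ I
    · obtain ⟨y, hy⟩ := Finset.card_eq_one.1 (by
        rw [Finset.card_sdiff_of_subset (hsL i hi), hLcard, hs] : (L \ s i).card = 1)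
      exact ⟨y, fun _ => hy⟩
    · exact ⟨x₀, fun h => absurd h hi⟩
  choose l hl using hmiss
  have hlmem : ∀ i ∈ I, l i ∈ L ∧ l i ∉ s i := fun i hi => by
    rw [← Finset.mem_sdiff, hl i hi]; exact Finset.mem_singleton_self _
  have hlinj : Set.InjOn l I := by
    intro i hi j hj hij
    by_contra hne'
    have hsub : (I.filter fun t => l i ∈ s t) ⊆ (I.erase i).erase j := by
      intro t ht
      obtain ⟨htI, hlt⟩ := mem_filter.1 ht
      refine Finset.mem_erase.2 ⟨?_, Finset.mem_erase.2 ⟨?_, htI⟩⟩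
      · rintro rfl
        exact (hlmem t hj).2 (hij ▸ hlt)
      · rintro rfl
        exact (hlmem t hi).2 hlt
    have := Finset.card_le_card hsub
    rw [herase i hi j hj (Ne.symm hne'), htwo _ (hlmem i hi).1] at this
    omega
  have hLim : I.image l = L := by
    refine Finset.eq_of_subset_of_card_le ?_ ?_
    · exact Finset.image_subset_iff.2 fun i hi => (hlmem i hi).1
    · rw [Finset.card_image_of_injOn hlinj, hLcard, hI]
  have hsim : ∀ i ∈ I, (I.erase i).image l = s i := by
    intro i hi
    refine Finset.eq_of_subset_of_card_le ?_ ?_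
    · refine Finset.image_subset_iff.2 fun j hj => ?_
      obtain ⟨hji, hjI⟩ := Finset.mem_erase.1 hj
      by_contra hlj
      have : l j ∈ L \ s i := Finset.mem_sdiff.2 ⟨(hlmem j hjI).1, hlj⟩
      rw [hl i hi, Finset.mem_singleton] at this
      exact hji (hlinj hjI hi this)
    · rw [Finset.card_image_of_injOn (hlinj.mono (Finset.erase_subset i I)),
        Finset.card_erase_of_mem hi, hI, hs]
  obtain ⟨u, v, huv, hsa⟩ := Finset.card_eq_two.1 (hs a)
  let f : Fin 5 ⊕ Bool → Fin n := Sum.elim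
    (fun i => if i ∈ I then l i else if i = a then u else v) (fun t => if t then x₀ else c a)
  have hfI : ∀ i ∈ I, f (Sum.inl i) = l i := fun i hi => by simp [f, hi]
  have hfa : f (Sum.inl a) = u := by simp [f, haI]
  have hbI : b ∉ I := by rw [← Finset.mem_compl, hIab]; simp
  have hfb : f (Sum.inl b) = v := by simp [f, hbI, hab.symm]
  have hft : f (Sum.inr true) = x₀ := by simp [f]
  have hff : f (Sum.inr false) = c a := by simp [f]
  have hsupp : support F ⊆ univ.image f := by
    intro x hx
    obtain ⟨i, hi⟩ := mem_support.1 hx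
    rw [Finset.mem_image]
    by_cases hiI : i ∈ I
    · rw [hvert, Finset.mem_insert, hcenter i hiI] at hi
      rcases hi with rfl | hi
      · exact ⟨_, mem_univ _, hft⟩
      · obtain ⟨j, hj, rfl⟩ := Finset.mem_image.1 (hLim.symm ▸ hsL i hiI hi : x ∈ I.image l)
        exact ⟨_, mem_univ _, hfI j hj⟩
    · rw [hnotI i hiI, hvert, hsa, Finset.mem_insert, Finset.mem_insert,
        Finset.mem_singleton] at hi
      rcases hi with rfl | rfl | rfl
      · exact ⟨_, mem_univ _, hff⟩
      · exact ⟨_, mem_univ _, hfa⟩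
      · exact ⟨_, mem_univ _, hfb⟩
  have hinj : Function.Injective f := by
    have h1 := Finset.card_le_card hsupp
    have h2 : (univ.image f).card = (univ : Finset (Fin 5 ⊕ Bool)).card := by
      refine le_antisymm Finset.card_image_le ?_
      rw [hS] at h1
      simpa using h1
    exact fun x y h => Finset.card_image_iff.1 h2 (Finset.mem_coe.2 (mem_univ x))
      (Finset.mem_coe.2 (mem_univ y)) h
  refine ⟨I, ⟨f, hinj⟩, hI, funext fun i => ?_⟩
  simp only [config, Function.Embedding.coeFn_mk]
  split_ifs with hi
  · rw [hFI i hi, hft, ← hsim i hi]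
    congr 1
    exact Finset.image_congr fun j hj => (hfI j (Finset.mem_of_mem_erase hj)).symm
  · rw [hnotI i hi, hff, hIab, Finset.image_insert, Finset.image_singleton, hfa, hfb, ← hsa, ← hF]

theorem card_support_add_nine_le_or_exists_config {F : Fin 5 → Finset (Edge n)}
    (hne : ∀ i, (F i).Nonempty ∧ Even (F i).card)
    (hpar : ∀ e, Even (univ.filter fun i => e ∈ F i).card) :
    (support F).card + 9 ≤ ∑ i, (vert (F i)).card ∨ ∃ I φ, I.card = 3 ∧ F = config I φ := by
  rw [or_iff_not_imp_left, not_le]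
  intro hlt
  have h3 : ∀ i ∈ (univ : Finset (Fin 5)), 3 ≤ (vert (F i)).card :=
    fun i _ => three_le_card_vert (hne i).1 (hne i).2
  have h15 : 15 ≤ ∑ i, (vert (F i)).card := by
    simpa using Finset.card_nsmul_le_sum univ _ 3 h3
  have h2 : (support F).card * 2 ≤ ∑ i, (vert (F i)).card := by
    rw [sum_card_vert]
    exact Finset.card_nsmul_le_sum _ _ 2 fun x hx => two_le_deg hpar hx
  have hcases : ((support F).card = 7 ∧ ∑ i, (vert (F i)).card = 15) ∨
      ((support F).card = 8 ∧ ∑ i, (vert (F i)).card = 16) := by omega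
  rcases hcases with ⟨hS, hsum⟩ | ⟨hS, hsum⟩
  · refine exists_config hne hpar hS fun i => ?_
    have heq : ∑ i : Fin 5, 3 = ∑ i, (vert (F i)).card := by rw [hsum]; simp
    exact ((Finset.sum_eq_sum_iff_of_le h3).1 heq i (mem_univ i)).symm
  · exfalso
    obtain ⟨a, _, ha, hv⟩ := exists_unique_excess h3 (by rw [hsum]; simp)
    have heq : ∑ x ∈ support F, 2 = ∑ x ∈ support F, deg F x := by
      rw [← sum_card_vert, hsum, Finset.sum_const, hS]; simp
    exact false_of_deg_two_of_one_large hne hpar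
      (fun x hx => ((Finset.sum_eq_sum_iff_of_le fun x hx => two_le_deg hpar hx).1 heq x hx).symm)
      ha fun i hi => hv i (mem_univ i) hi

lemma inl_inj (φ : Fin 5 ⊕ Bool ↪ Fin n) : Function.Injective fun j => φ (Sum.inl j) :=
  φ.injective.comp Sum.inl_injective

lemma inr_notMem (φ : Fin 5 ⊕ Bool ↪ Fin n) (t : Bool) (A : Finset (Fin 5)) :
    φ (Sum.inr t) ∉ A.image fun j => φ (Sum.inl j) := by
  simp

lemma card_image_inl (φ : Fin 5 ⊕ Bool ↪ Fin n) (A : Finset (Fin 5)) :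
    (A.image fun j => φ (Sum.inl j)).card = A.card :=
  Finset.card_image_of_injective _ (inl_inj φ)

lemma exists_config_eq_cherry {I : Finset (Fin 5)} (hI : I.card = 3) (φ : Fin 5 ⊕ Bool ↪ Fin n)
    (i : Fin 5) : ∃ c s, c ∉ s ∧ s.card = 2 ∧ config I φ i = cherry c s := by
  rw [config]
  split_ifs with hi
  · refine ⟨_, _, inr_notMem φ _ _, ?_, rfl⟩
    rw [card_image_inl, Finset.card_erase_of_mem hi, hI]
  · refine ⟨_, _, inr_notMem φ _ _, ?_, rfl⟩
    rw [card_image_inl, Finset.card_compl, hI, Fintype.card_fin]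

lemma card_config {I : Finset (Fin 5)} (hI : I.card = 3) (φ : Fin 5 ⊕ Bool ↪ Fin n)
    (i : Fin 5) : (config I φ i).card = 2 := by
  obtain ⟨c, s, hc, hs, h⟩ := exists_config_eq_cherry hI φ i
  rw [h, card_cherry hc, hs]

lemma card_vert_config {I : Finset (Fin 5)} (hI : I.card = 3) (φ : Fin 5 ⊕ Bool ↪ Fin n)
    (i : Fin 5) : (vert (config I φ i)).card = 3 := by
  obtain ⟨c, s, hc, hs, h⟩ := exists_config_eq_cherry hI φ i
  rw [h, vert_cherry hc (Finset.card_pos.1 (by omega)), Finset.card_insert_of_notMem hc, hs]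

lemma config_mem_evenFamilies {I : Finset (Fin 5)} (hI : I.card = 3) (φ : Fin 5 ⊕ Bool ↪ Fin n) :
    config I φ ∈ evenFamilies n 5 := by
  have hIc : Iᶜ.card = 2 := by rw [Finset.card_compl, hI, Fintype.card_fin]
  refine mem_filter.2 ⟨mem_univ _, fun i => ⟨?_, ?_⟩, fun e => ?_⟩
  · rw [← Finset.card_pos, card_config hI]; norm_num
  · rw [card_config hI]; norm_num
  · have hsplit : (univ.filter fun i => e ∈ config I φ i).card =
        (I.filter fun i => e ∈ config I φ i).card + (Iᶜ.filter fun i => e ∈ config I φ i).card := by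
      rw [← Finset.card_union_of_disjoint, ← Finset.filter_union, Finset.union_compl]
      exact Finset.disjoint_filter_filter disjoint_compl_right
    rw [hsplit]
    refine Even.add ?_ ?_
    · by_cases he : ∃ j ∈ I, e.1 = {φ (Sum.inr true), φ (Sum.inl j)}
      · obtain ⟨j, hj, he⟩ := he
        have hfil : (I.filter fun i => e ∈ config I φ i) = I.erase j := by
          ext i
          rw [mem_filter, Finset.mem_erase, and_comm]
          refine and_congr_left fun hi => ?_
          rw [config, if_pos hi]
          have hee : e = ⟨{φ (Sum.inr true), φ (Sum.inl j)}, he ▸ e.2⟩ := Subtype.ext he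
          rw [hee, pair_mem_cherry, Finset.mem_image]
          constructor
          · rintro ⟨t, ht, htj⟩
            rw [← inl_inj φ htj]
            exact (Finset.mem_erase.1 ht).1.symm
          · exact fun hij => ⟨j, Finset.mem_erase.2 ⟨hij.symm, hj⟩, rfl⟩
        rw [hfil, Finset.card_erase_of_mem hj, hI]; norm_num
      · have hfil : (I.filter fun i => e ∈ config I φ i) = ∅ := by
          refine Finset.filter_eq_empty_iff.2 fun i hi hei => he ?_
          rw [config, if_pos hi, mem_cherry] at hei
          obtain ⟨x, hx, hex⟩ := hei
          obtain ⟨j, hj, rfl⟩ := Finset.mem_image.1 hx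
          exact ⟨j, Finset.mem_of_mem_erase hj, hex⟩
        rw [hfil]; simp
    · have hc : ∀ i ∈ Iᶜ, config I φ i =
          cherry (φ (Sum.inr false)) (Iᶜ.image fun j => φ (Sum.inl j)) := fun i hi => by
        rw [config, if_neg (Finset.mem_compl.1 hi)]
      by_cases he : e ∈ cherry (φ (Sum.inr false)) (Iᶜ.image fun j => φ (Sum.inl j))
      · rw [Finset.filter_true_of_mem fun i hi => by rwa [hc i hi], hIc]; norm_num
      · rw [Finset.filter_false_of_mem fun i hi => by rwa [hc i hi]]; simp

lemma subset_of_config_eq {I J : Finset (Fin 5)} (hI : I.card = 3) (hJ : J.card = 3)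
    {φ ψ : Fin 5 ⊕ Bool ↪ Fin n} (h : config I φ = config J ψ) : I ⊆ J := by
  have key : ∀ i, (if i ∈ I then φ (Sum.inr true) else φ (Sum.inr false)) =
      if i ∈ J then ψ (Sum.inr true) else ψ (Sum.inr false) := by
    have aux : ∀ {I : Finset (Fin 5)} (_ : I.card = 3) (φ : Fin 5 ⊕ Bool ↪ Fin n) (i : Fin 5),
        ∃ s, (if i ∈ I then φ (Sum.inr true) else φ (Sum.inr false)) ∉ s ∧ 2 ≤ s.card ∧
          config I φ i = cherry (if i ∈ I then φ (Sum.inr true) else φ (Sum.inr false)) s := by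
      intro I hI φ i
      rw [config]
      split_ifs with hi
      · refine ⟨_, inr_notMem φ _ _, ?_, rfl⟩
        rw [card_image_inl, Finset.card_erase_of_mem hi, hI]
      · refine ⟨_, inr_notMem φ _ _, ?_, rfl⟩
        rw [card_image_inl, Finset.card_compl, hI, Fintype.card_fin]
    intro i
    obtain ⟨s, hs, hs2, hi⟩ := aux hI φ i
    obtain ⟨t, ht, ht2, hj⟩ := aux hJ ψ i
    exact (cherry_inj hs ht hs2 ht2 (hi.symm.trans ((congrFun h i).trans hj))).1
  obtain ⟨t, ht⟩ : (I ∩ J).Nonempty := by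
    rw [← Finset.card_pos]
    have h1 := Finset.card_union_add_card_inter I J
    have h2 := Finset.card_le_univ (I ∪ J)
    rw [Fintype.card_fin] at h2
    omega
  obtain ⟨htI, htJ⟩ := Finset.mem_inter.1 ht
  have hct := key t
  rw [if_pos htI, if_pos htJ] at hct
  intro i hi
  by_contra hiJ
  have hci := key i
  rw [if_pos hi, if_neg hiJ, hct] at hci
  simpa using ψ.injective hci

lemma eq_or_eq_swap_of_config_eq {I : Finset (Fin 5)} (hI : I.card = 3) {a b : Fin 5}
    (hab : a ≠ b) (hIc : Iᶜ = {a, b}) {φ ψ : Fin 5 ⊕ Bool ↪ Fin n} (h : config I φ = config I ψ) :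
    ψ = φ ∨ ψ = (Equiv.swap (Sum.inl a) (Sum.inl b)).toEmbedding.trans φ := by
  have haI : a ∉ I := by rw [← Finset.mem_compl, hIc]; simp
  have hbI : b ∉ I := by rw [← Finset.mem_compl, hIc]; simp
  have hin : ∀ i ∈ I, φ (Sum.inr true) = ψ (Sum.inr true) ∧
      ((I.erase i).image fun j => φ (Sum.inl j)) = (I.erase i).image fun j => ψ (Sum.inl j) := by
    intro i hi
    have hi' := congrFun h i
    rw [config, config, if_pos hi, if_pos hi] at hi'
    have h2 : 2 ≤ (I.erase i).card := by rw [Finset.card_erase_of_mem hi, hI]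
    exact cherry_inj (inr_notMem _ _ _) (inr_notMem _ _ _) (by rwa [card_image_inl])
      (by rwa [card_image_inl]) hi'
  have hout : φ (Sum.inr false) = ψ (Sum.inr false) ∧
      (Iᶜ.image fun j => φ (Sum.inl j)) = Iᶜ.image fun j => ψ (Sum.inl j) := by
    have hi' := congrFun h a
    rw [config, config, if_neg haI, if_neg haI] at hi'
    have h2 : 2 ≤ Iᶜ.card := by rw [hIc, Finset.card_pair hab]
    exact cherry_inj (inr_notMem _ _ _) (inr_notMem _ _ _) (by rwa [card_image_inl])
      (by rwa [card_image_inl]) hi'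
  have htrue : φ (Sum.inr true) = ψ (Sum.inr true) := by
    obtain ⟨i, hi⟩ := Finset.card_pos.1 (by omega : 0 < I.card)
    exact (hin i hi).1
  have hleaf : ∀ i ∈ I, ψ (Sum.inl i) = φ (Sum.inl i) := by
    intro i hi
    have hmem : ∀ j ∈ I, j ≠ i → ∃ t ∈ I.erase j, φ (Sum.inl t) = ψ (Sum.inl i) := by
      intro j hj hji
      rw [← Finset.mem_image (f := fun t => φ (Sum.inl t)), (hin j hj).2]
      exact Finset.mem_image_of_mem _ (Finset.mem_erase.2 ⟨hji.symm, hi⟩)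
    obtain ⟨j, hj, hji⟩ := Finset.exists_mem_ne (by omega : 1 < I.card) i
    obtain ⟨t, ht, htψ⟩ := hmem j hj hji
    by_cases hti : t = i
    · rw [← htψ, hti]
    · obtain ⟨r, hr, hrψ⟩ := hmem t (Finset.mem_of_mem_erase ht) hti
      exact absurd (inl_inj φ (hrψ.trans htψ.symm)) (Finset.mem_erase.1 hr).1
  have hpair : ({φ (Sum.inl a), φ (Sum.inl b)} : Finset (Fin n)) =
      {ψ (Sum.inl a), ψ (Sum.inl b)} := by
    have := hout.2
    rwa [hIc, Finset.image_insert, Finset.image_singleton, Finset.image_insert,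
      Finset.image_singleton] at this
  have hpsi : ψ (Sum.inl a) ≠ ψ (Sum.inl b) := fun h => hab (inl_inj ψ h)
  have h1 : ψ (Sum.inl a) = φ (Sum.inl a) ∨ ψ (Sum.inl a) = φ (Sum.inl b) := by
    have : ψ (Sum.inl a) ∈ ({φ (Sum.inl a), φ (Sum.inl b)} : Finset (Fin n)) := hpair ▸ by simp
    simpa only [Finset.mem_insert, Finset.mem_singleton] using this
  have h2 : ψ (Sum.inl b) = φ (Sum.inl a) ∨ ψ (Sum.inl b) = φ (Sum.inl b) := by
    have : ψ (Sum.inl b) ∈ ({φ (Sum.inl a), φ (Sum.inl b)} : Finset (Fin n)) := hpair ▸ by simp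
    simpa only [Finset.mem_insert, Finset.mem_singleton] using this
  have hcases : ∀ i, i ∈ I ∨ i = a ∨ i = b := fun i => by
    by_cases hi : i ∈ I
    · exact Or.inl hi
    · rw [← Finset.mem_compl, hIc] at hi
      simpa using Or.inr (by simpa using hi)
  rcases h1 with h1 | h1
  · left
    have h2 : ψ (Sum.inl b) = φ (Sum.inl b) := h2.resolve_left fun h => hpsi (h1.trans h.symm)
    ext1 x
    rcases x with i | _ | _
    · rcases hcases i with hi | rfl | rfl
      exacts [hleaf i hi, h1, h2]
    exacts [hout.1.symm, htrue.symm]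
  · right
    have h2 : ψ (Sum.inl b) = φ (Sum.inl a) := h2.resolve_right fun h => hpsi (h1.trans h.symm)
    ext1 x
    simp only [Function.Embedding.trans_apply, Equiv.coe_toEmbedding]
    rcases x with i | _ | _
    · rcases hcases i with hi | rfl | rfl
      · rw [Equiv.swap_apply_of_ne_of_ne, hleaf i hi]
        · rintro ⟨⟩; exact haI hi
        · rintro ⟨⟩; exact hbI hi
      · rw [Equiv.swap_apply_left, h1]
      · rw [Equiv.swap_apply_right, h2]
    · rw [Equiv.swap_apply_of_ne_of_ne (by simp) (by simp), hout.1]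
    · rw [Equiv.swap_apply_of_ne_of_ne (by simp) (by simp), htrue]

lemma config_swap {I : Finset (Fin 5)} {a b : Fin 5} (hIc : Iᶜ = {a, b})
    (φ : Fin 5 ⊕ Bool ↪ Fin n) :
    config I ((Equiv.swap (Sum.inl a) (Sum.inl b)).toEmbedding.trans φ) = config I φ := by
  have haI : a ∉ I := by rw [← Finset.mem_compl, hIc]; simp
  have hbI : b ∉ I := by rw [← Finset.mem_compl, hIc]; simp
  funext i
  simp only [config, Function.Embedding.trans_apply, Equiv.coe_toEmbedding]
  rw [Equiv.swap_apply_of_ne_of_ne (by simp) (by simp),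
    Equiv.swap_apply_of_ne_of_ne (by simp) (by simp)]
  split_ifs with hi
  · congr 1
    refine Finset.image_congr fun j hj => ?_
    have hjI : j ∈ I := Finset.mem_of_mem_erase hj
    rw [Equiv.swap_apply_of_ne_of_ne]
    · rintro ⟨⟩; exact haI hjI
    · rintro ⟨⟩; exact hbI hjI
  · congr 1
    simp only [hIc, Finset.image_insert, Finset.image_singleton, Equiv.swap_apply_left,
      Equiv.swap_apply_right]
    exact Finset.pair_comm _ _

/-- The set of extremal families. -/
noncomputable def mainFamilies (n : ℕ) : Finset (Fin 5 → Finset (Edge n)) :=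
  (univ.powersetCard 3 ×ˢ univ).image fun p : Finset (Fin 5) × (Fin 5 ⊕ Bool ↪ Fin n) =>
    config p.1 p.2

lemma mem_mainFamilies {F : Fin 5 → Finset (Edge n)} :
    F ∈ mainFamilies n ↔ ∃ I φ, I.card = 3 ∧ F = config I φ := by
  simp only [mainFamilies, Finset.mem_image, Finset.mem_product, mem_univ, and_true,
    Finset.mem_powersetCard, Finset.subset_univ, true_and, Prod.exists]
  exact exists_congr fun I => exists_congr fun φ => and_congr_right fun _ => eq_comm

lemma card_mainFamilies : (mainFamilies n).card = 5 * n.descFactorial 7 := by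
  have hfib : ∀ F ∈ mainFamilies n,
      (((univ : Finset (Fin 5)).powersetCard 3 ×ˢ
        (univ : Finset (Fin 5 ⊕ Bool ↪ Fin n))).filter fun p => config p.1 p.2 = F).card = 2 := by
    intro F hF
    obtain ⟨I, φ, hI, rfl⟩ := mem_mainFamilies.1 hF
    obtain ⟨a, b, hab, hIc⟩ := Finset.card_eq_two.1
      (by rw [Finset.card_compl, hI, Fintype.card_fin] : Iᶜ.card = 2)
    refine Finset.card_eq_two.2
      ⟨(I, φ), (I, (Equiv.swap (Sum.inl a) (Sum.inl b)).toEmbedding.trans φ), ?_, ?_⟩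
    · intro h
      have h1 := DFunLike.congr_fun (congrArg Prod.snd h) (Sum.inl a)
      simp only [Function.Embedding.trans_apply, Equiv.coe_toEmbedding,
        Equiv.swap_apply_left] at h1
      exact hab (inl_inj φ h1)
    · ext ⟨J, ψ⟩
      simp only [mem_filter, Finset.mem_product, mem_univ, and_true, Finset.mem_powersetCard,
        Finset.subset_univ, true_and, Finset.mem_insert, Finset.mem_singleton, Prod.mk.injEq]
      constructor
      · rintro ⟨hJ, h⟩
        obtain rfl : J = I := Finset.Subset.antisymm (subset_of_config_eq hJ hI h)
          (subset_of_config_eq hI hJ h.symm)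
        simpa using eq_or_eq_swap_of_config_eq hI hab hIc h.symm
      · rintro (⟨rfl, rfl⟩ | ⟨rfl, rfl⟩)
        · exact ⟨hI, rfl⟩
        · exact ⟨hI, config_swap hIc φ⟩
  have h := Finset.card_eq_sum_card_fiberwise
    (s := (univ : Finset (Fin 5)).powersetCard 3 ×ˢ (univ : Finset (Fin 5 ⊕ Bool ↪ Fin n)))
    (t := mainFamilies n) (f := fun p => config p.1 p.2)
    (fun p hp => Finset.mem_image_of_mem _ hp)
  rw [Finset.sum_congr rfl hfib, Finset.card_product, Finset.card_powersetCard, Finset.card_univ,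
    Finset.card_univ, Fintype.card_embedding_eq, Finset.sum_const, smul_eq_mul] at h
  simp only [Fintype.card_sum, Fintype.card_fin, Fintype.card_bool] at h
  have h10 : Nat.choose 5 3 = 10 := rfl
  rw [h10, show 5 + 2 = 7 from rfl] at h
  omega

lemma extCount_eq_zero {k : ℕ} {F : Finset (Edge n)} (h : k < (vert F).card) :
    extCount k F = 0 := by
  rw [extCount, Finset.card_eq_zero, Finset.filter_eq_empty_iff]
  intro S hS hsub
  have := Finset.card_le_card hsub
  rw [(mem_powersetCard.1 hS).2] at this
  omega

lemma extCount_eq_choose {k : ℕ} {F : Finset (Edge n)} (h : (vert F).card ≤ k) :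
    extCount k F = (n - (vert F).card).choose (k - (vert F).card) := by
  have hc : (vert F)ᶜ.card = n - (vert F).card := by rw [Finset.card_compl, Fintype.card_fin]
  rw [extCount, ← hc, ← Finset.card_powersetCard]
  refine Finset.card_bij' (fun S _ => S \ vert F) (fun T _ => T ∪ vert F) ?_ ?_ ?_ ?_
  · intro S hS
    obtain ⟨hS, hsub⟩ := mem_filter.1 hS
    refine mem_powersetCard.2 ⟨fun x hx => Finset.mem_compl.2 (Finset.mem_sdiff.1 hx).2, ?_⟩
    rw [Finset.card_sdiff_of_subset hsub, (mem_powersetCard.1 hS).2]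
  · intro T hT
    obtain ⟨hT, hcard⟩ := mem_powersetCard.1 hT
    refine mem_filter.2 ⟨mem_powersetCard.2 ⟨Finset.subset_univ _, ?_⟩, Finset.subset_union_right⟩
    rw [Finset.card_union_of_disjoint (Finset.subset_compl_iff_disjoint_right.1 hT), hcard]
    omega
  · intro S hS
    exact Finset.sdiff_union_of_subset (mem_filter.1 hS).2
  · intro T hT
    exact Finset.union_sdiff_cancel_right
      (Finset.subset_compl_iff_disjoint_right.1 (mem_powersetCard.1 hT).1)

lemma extCount_le_pow {k : ℕ} {F : Finset (Edge n)} (h : (vert F).card ≤ k) :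
    extCount k F ≤ n ^ (k - (vert F).card) := by
  rw [extCount_eq_choose h]
  exact (Nat.choose_le_pow _ _).trans (Nat.pow_le_pow_left (Nat.sub_le _ _) _)

lemma prod_extCount_le {k m : ℕ} (hn : 0 < n) {F : Fin m → Finset (Edge n)} {r : ℕ}
    (hF : (support F).card + r ≤ ∑ i, (vert (F i)).card) :
    ∏ i, extCount k (F i) ≤
      if (support F).card + r ≤ m * k then n ^ (m * k - r - (support F).card) else 0 := by
  by_cases hv : ∀ i, (vert (F i)).card ≤ k
  · have h1 : ∏ i, extCount k (F i) ≤ n ^ ∑ i, (k - (vert (F i)).card) := by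
      rw [← Finset.prod_pow_eq_pow_sum]
      exact Finset.prod_le_prod' fun i _ => extCount_le_pow (hv i)
    have h2 : ∑ i, (k - (vert (F i)).card) + ∑ i, (vert (F i)).card = m * k := by
      rw [← Finset.sum_add_distrib, Finset.sum_congr rfl fun i _ => Nat.sub_add_cancel (hv i)]
      simp
    rw [if_pos (by omega)]
    exact h1.trans (Nat.pow_le_pow_right hn (by omega))
  · push Not at hv
    obtain ⟨i, hi⟩ := hv
    rw [Finset.prod_eq_zero (mem_univ i) (extCount_eq_zero hi)]
    exact Nat.zero_le _

lemma card_filter_support_eq_le (m : ℕ) (U : Finset (Fin n)) :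
    (univ.filter fun F : Fin m → Finset (Edge n) => support F = U).card ≤
      (2 ^ U.card.choose 2) ^ m := by
  have hsub : (univ.filter fun F : Fin m → Finset (Edge n) => support F = U) ⊆
      Fintype.piFinset fun _ => (edgesIn U).powerset := by
    intro F hF
    refine Fintype.mem_piFinset.2 fun i => Finset.mem_powerset.2 (subset_edgesIn_iff.2 ?_)
    rw [← (mem_filter.1 hF).2]
    exact Finset.subset_biUnion_of_mem (fun i => vert (F i)) (mem_univ i)
  refine (Finset.card_le_card hsub).trans_eq ?_
  rw [Fintype.card_piFinset]
  simp [card_edgesIn]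

lemma sum_pow_sub_card_support_le (m M r : ℕ) :
    ∑ F : Fin m → Finset (Edge n),
      (if (support F).card + r ≤ M then n ^ (M - r - (support F).card) else 0) ≤
      (M + 1) * (2 ^ M.choose 2) ^ m * n ^ (M - r) := by
  rw [← Finset.sum_fiberwise (g := fun F : Fin m → Finset (Edge n) => support F)]
  have h1 : ∀ U : Finset (Fin n), ∑ F : Fin m → Finset (Edge n) with support F = U,
      (if (support F).card + r ≤ M then n ^ (M - r - (support F).card) else 0) ≤
      (2 ^ M.choose 2) ^ m * if U.card + r ≤ M then n ^ (M - r - U.card) else 0 := by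
    intro U
    rw [Finset.sum_congr rfl fun F hF => by rw [(mem_filter.1 hF).2], Finset.sum_const,
      smul_eq_mul]
    split_ifs with hU
    · refine Nat.mul_le_mul_right _ ((card_filter_support_eq_le m U).trans ?_)
      gcongr
      · norm_num
      · omega
    · simp
  refine (Finset.sum_le_sum fun U _ => h1 U).trans ?_
  rw [← Finset.mul_sum, ← Finset.powerset_univ,
    Finset.sum_powerset_apply_card fun j => if j + r ≤ M then n ^ (M - r - j) else 0]
  have h2 : ∑ j ∈ Finset.range ((univ : Finset (Fin n)).card + 1),
      (univ : Finset (Fin n)).card.choose j • (if j + r ≤ M then n ^ (M - r - j) else 0) ≤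
      (M + 1) * n ^ (M - r) := by
    have h3 : ∀ j, (univ : Finset (Fin n)).card.choose j •
        (if j + r ≤ M then n ^ (M - r - j) else 0) ≤ if j ≤ M then n ^ (M - r) else 0 := by
      intro j
      rw [Finset.card_univ, Fintype.card_fin, smul_eq_mul]
      split_ifs with h4 h5
      · refine (Nat.mul_le_mul_right _ (Nat.choose_le_pow n j)).trans_eq ?_
        rw [← pow_add]
        congr 1
        omega
      · omega
      · simp
      · simp
    refine (Finset.sum_le_sum fun j _ => h3 j).trans ?_
    rw [← Finset.sum_filter, Finset.sum_const, smul_eq_mul]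
    refine Nat.mul_le_mul_right _ ?_
    rw [← Finset.card_range (M + 1)]
    refine Finset.card_le_card fun j hj => Finset.mem_range.2 ?_
    have := (mem_filter.1 hj).2
    omega
  calc _ ≤ (2 ^ M.choose 2) ^ m * ((M + 1) * n ^ (M - r)) := Nat.mul_le_mul_left _ h2
    _ = _ := by ring

lemma sum_evenFamilies_sdiff_le (k : ℕ) (hn : 0 < n) :
    ∑ F ∈ evenFamilies n 5 \ mainFamilies n, ∏ i, extCount k (F i) ≤
      (5 * k + 1) * (2 ^ (5 * k).choose 2) ^ 5 * n ^ (5 * k - 9) := by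
  refine (Finset.sum_le_sum (g := fun F => if (support F).card + 9 ≤ 5 * k then
    n ^ (5 * k - 9 - (support F).card) else 0) fun F hF => ?_).trans ?_
  · obtain ⟨hF, hmain⟩ := Finset.mem_sdiff.1 hF
    obtain ⟨hne, hpar⟩ := (mem_filter.1 hF).2
    refine prod_extCount_le hn ?_
    exact (card_support_add_nine_le_or_exists_config hne hpar).resolve_right
      fun h => hmain (mem_mainFamilies.2 h)
  · exact (Finset.sum_le_sum_of_subset (Finset.subset_univ _)).trans
      (sum_pow_sub_card_support_le 5 (5 * k) 9)

lemma sum_mainFamilies {k : ℕ} (hk : 3 ≤ k) :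
    ∑ F ∈ mainFamilies n, ∏ i, extCount k (F i) =
      5 * n.descFactorial 7 * ((n - 3).choose (k - 3)) ^ 5 := by
  have h : ∀ F ∈ mainFamilies n, ∏ i, extCount k (F i) = ((n - 3).choose (k - 3)) ^ 5 := by
    intro F hF
    obtain ⟨I, φ, hI, rfl⟩ := mem_mainFamilies.1 hF
    have : ∀ i, extCount k (config I φ i) = (n - 3).choose (k - 3) := fun i => by
      have hv := card_vert_config hI φ i
      rw [extCount_eq_choose (by omega), hv]
    simp [this]
  rw [Finset.sum_congr rfl h, Finset.sum_const, smul_eq_mul, card_mainFamilies]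

lemma exists_centralMoment_five_eq {k : ℕ} (hk : 3 ≤ k) (hn : 0 < n) :
    ∃ r : ℕ, r ≤ (5 * k + 1) * (2 ^ (5 * k).choose 2) ^ 5 * n ^ (5 * k - 9) ∧
      centralMoment n k 5 = (2 / 2 ^ k.choose 2) ^ 5 *
        (5 * (n.descFactorial 7 : ℝ) * ((n - 3).choose (k - 3) : ℝ) ^ 5 + r) := by
  refine ⟨_, sum_evenFamilies_sdiff_le k hn, ?_⟩
  rw [centralMoment_eq_sum (by omega)]
  congr 1
  have hsub : mainFamilies n ⊆ evenFamilies n 5 := fun F hF => by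
    obtain ⟨I, φ, hI, rfl⟩ := mem_mainFamilies.1 hF
    exact config_mem_evenFamilies hI φ
  have h := Finset.sum_sdiff hsub (f := fun F => ∏ i, extCount k (F i))
  rw [sum_mainFamilies hk, add_comm] at h
  exact_mod_cast h.symm

open Filter Topology

lemma tendsto_descFactorial_div_pow (m : ℕ) :
    Tendsto (fun n : ℕ => (n.descFactorial m : ℝ) / (n : ℝ) ^ m) atTop (𝓝 1) := by
  refine (Asymptotics.isEquivalent_iff_tendsto_one ?_).1 (isEquivalent_descFactorial m)
  filter_upwards [eventually_gt_atTop 0] with n hn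
  positivity

lemma tendsto_choose_sub_mul_factorial_div_pow (r m : ℕ) :
    Tendsto (fun n : ℕ => ((n - r).choose m : ℝ) * (m.factorial : ℝ) / (n : ℝ) ^ m)
      atTop (𝓝 1) := by
  have h := (tendsto_descFactorial_div_pow (m + r)).div (tendsto_descFactorial_div_pow r)
    one_ne_zero
  rw [div_one] at h
  refine h.congr' ?_
  filter_upwards [eventually_ge_atTop (r + 1)] with n hn
  have h1 := Nat.descFactorial_mul_descFactorial (n := n) (Nat.le_add_left r m)
  rw [Nat.add_sub_cancel, Nat.descFactorial_eq_factorial_mul_choose (n - r) m] at h1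
  have h2 : 0 < n.descFactorial r := Nat.descFactorial_pos.2 (by omega)
  have h3 : (0 : ℝ) < n := by exact_mod_cast (by omega : 0 < n)
  have h4 : (n.descFactorial r : ℝ) ≠ 0 := by exact_mod_cast h2.ne'
  simp only [Pi.div_apply]
  rw [← h1]
  push_cast
  field_simp
  ring

end MonochromaticCliques

open MonochromaticCliques

theorem fifth_central_moment_asymptotic (k : ℕ) (hk : 3 ≤ k) :
    Filter.Tendsto (fun n : ℕ =>
      centralMoment n k 5 /
        (5 * (1 / ((k - 3).factorial : ℝ) ^ 5) * (n : ℝ) ^ (5 * k - 8) /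
          (2 : ℝ) ^ (5 * k.choose 2 - 5)))
      Filter.atTop (nhds 1) := by
  set K : ℝ := (5 * k + 1) * (2 ^ (5 * k).choose 2) ^ 5 with hK
  have hfac : (0 : ℝ) < (k - 3).factorial := by exact_mod_cast Nat.factorial_pos _
  have hmain := (tendsto_descFactorial_div_pow 7).mul
    ((tendsto_choose_sub_mul_factorial_div_pow 3 (k - 3)).pow 5)
  rw [one_pow, one_mul] at hmain
  have hupper : Filter.Tendsto (fun n : ℕ => K * ((k - 3).factorial : ℝ) ^ 5 / 5 * (n : ℝ)⁻¹)
      Filter.atTop (nhds 0) := by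
    have h := ((tendsto_inv_atTop_zero (𝕜 := ℝ)).comp
      (tendsto_natCast_atTop_atTop (R := ℝ))).const_mul (K * ((k - 3).factorial : ℝ) ^ 5 / 5)
    rw [mul_zero] at h
    exact h
  have hmain' := hmain.add hupper
  rw [add_zero] at hmain'
  refine tendsto_of_tendsto_of_tendsto_of_le_of_le' hmain hmain' ?_ ?_
  all_goals
    filter_upwards [Filter.eventually_gt_atTop 0] with n hn
    obtain ⟨r, hr, heq⟩ := exists_centralMoment_five_eq hk hn
    have hr' : (r : ℝ) ≤ K * (n : ℝ) ^ (5 * k - 9) := by rw [hK]; exact_mod_cast hr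
    have hn' : (0 : ℝ) < n := by exact_mod_cast hn
    have hchoose : 3 ≤ k.choose 2 := Nat.choose_le_choose 2 hk
    have hpow2 : (2 / 2 ^ k.choose 2 : ℝ) ^ 5 = 1 / 2 ^ (5 * k.choose 2 - 5) := by
      rw [div_pow, div_eq_div_iff (by positivity) (by positivity), one_mul, ← pow_mul, ← pow_add]
      congr 1
      omega
    have hpown : (n : ℝ) ^ (5 * k - 8) = n ^ 7 * (n ^ (k - 3)) ^ 5 := by
      rw [← pow_mul, ← pow_add]
      congr 1
      omega
    have hratio : centralMoment n k 5 /
        (5 * (1 / ((k - 3).factorial : ℝ) ^ 5) * (n : ℝ) ^ (5 * k - 8) /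
          (2 : ℝ) ^ (5 * k.choose 2 - 5)) =
        (n.descFactorial 7 : ℝ) / n ^ 7 *
          (((n - 3).choose (k - 3) : ℝ) * (k - 3).factorial / n ^ (k - 3)) ^ 5 +
        r * (k - 3).factorial ^ 5 / (5 * n ^ (5 * k - 8)) := by
      rw [heq, hpow2, hpown]
      field_simp
    rw [hratio]
  · exact le_add_of_nonneg_right (by positivity)
  · refine add_le_add le_rfl ?_
    rw [div_le_iff₀ (by positivity), show 5 * k - 8 = 5 * k - 9 + 1 by omega, pow_succ]
    calc (r : ℝ) * (k - 3).factorial ^ 5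
        ≤ K * (n : ℝ) ^ (5 * k - 9) * (k - 3).factorial ^ 5 := by gcongr
      _ = _ := by field_simp; ring
end

section
/- Fix an integer k ≥ 3, let μ = E[X], and let Var(X) = E[(X − μ)²]. As n → ∞, the standardized central moments of X converge to those of the standard normal distribution up to order five: E[(X − μ)³]/Var(X)^(3/2) → 0, E[(X − μ)⁴]/Var(X)² → 3, and E[(X − μ)⁵]/Var(X)^(5/2) → 0. -/
open Finset

/-- The edges of the complete graph on `Fin n`. -/
abbrev EdgeOf (n : ℕ) : Type := {e : Finset (Fin n) // e.card = 2}

/-! ### Expectation over uniform colorings -/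

lemma card_edgeColoring_pos (n : ℕ) : (0 : ℝ) < Fintype.card (EdgeColoring n) := by
  exact_mod_cast Fintype.card_pos

lemma expec_const (n : ℕ) (a : ℝ) : expec n (fun _ => a) = a := by
  have := (card_edgeColoring_pos n).ne'
  rw [expec, sum_const, card_univ, nsmul_eq_mul]
  field_simp

lemma expec_sum {α : Type*} (n : ℕ) (s : Finset α) (f : α → EdgeColoring n → ℝ) :
    expec n (fun c => ∑ a ∈ s, f a c) = ∑ a ∈ s, expec n (f a) := by
  simp only [expec]
  rw [sum_comm, sum_div]

lemma expec_add (n : ℕ) (f g : EdgeColoring n → ℝ) :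
    expec n (fun c => f c + g c) = expec n f + expec n g := by
  simp only [expec, sum_add_distrib, add_div]

lemma expec_sub (n : ℕ) (f g : EdgeColoring n → ℝ) :
    expec n (fun c => f c - g c) = expec n f - expec n g := by
  simp only [expec, sum_sub_distrib, sub_div]

lemma expec_const_mul (n : ℕ) (a : ℝ) (f : EdgeColoring n → ℝ) :
    expec n (fun c => a * f c) = a * expec n f := by
  simp only [expec, ← mul_sum, mul_div_assoc]

lemma expec_comp_equiv (n : ℕ) (φ : EdgeColoring n ≃ EdgeColoring n) (f : EdgeColoring n → ℝ) :
    expec n (fun c => f (φ c)) = expec n f := by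
  simp only [expec, Equiv.sum_comp φ f]

lemma expec_mono (n : ℕ) {f g : EdgeColoring n → ℝ} (h : ∀ c, f c ≤ g c) :
    expec n f ≤ expec n g := by
  simp only [expec]
  exact div_le_div_of_nonneg_right (sum_le_sum fun c _ => h c) (card_edgeColoring_pos n).le

lemma abs_expec_le_one (n : ℕ) {f : EdgeColoring n → ℝ} (h : ∀ c, |f c| ≤ 1) :
    |expec n f| ≤ 1 := by
  rw [abs_le]
  constructor
  · simpa [expec_const] using expec_mono n (f := fun _ => (-1 : ℝ)) fun c => (abs_le.1 (h c)).1
  · simpa [expec_const] using expec_mono n (g := fun _ => (1 : ℝ)) fun c => (abs_le.1 (h c)).2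

/-- Functions of disjoint sets of edges are uncorrelated. -/
lemma expec_mul_of_dependsOn (n : ℕ) {A B : Set (EdgeOf n)} (hAB : Disjoint A B)
    {f g : EdgeColoring n → ℝ} (hf : DependsOn f A) (hg : DependsOn g B) :
    expec n (fun c => f c * g c) = expec n f * expec n g := by
  classical
  let mix (c d : EdgeColoring n) : EdgeColoring n := fun e => if e ∈ A then c e else d e
  let φ : EdgeColoring n × EdgeColoring n ≃ EdgeColoring n × EdgeColoring n :=
    Function.Involutive.toPerm (fun p => (mix p.1 p.2, mix p.2 p.1)) (by
      rintro ⟨c, d⟩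
      ext e <;> by_cases he : e ∈ A <;> simp [mix, he])
  have key : ∑ p : EdgeColoring n × EdgeColoring n, f p.1 * g p.2
      = ∑ p : EdgeColoring n × EdgeColoring n, f p.1 * g p.1 := by
    rw [← Equiv.sum_comp φ]
    refine sum_congr rfl fun p _ => ?_
    have h1 : f (φ p).1 = f p.1 := hf fun e he => if_pos he
    have h2 : g (φ p).2 = g p.1 := hg fun e he =>
      if_neg (hAB.notMem_of_mem_right he)
    rw [h1, h2]
  rw [← univ_product_univ, sum_product, sum_product] at key
  simp only [← mul_sum, ← sum_mul, sum_const, card_univ, nsmul_eq_mul] at key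
  have := (card_edgeColoring_pos n).ne'
  simp only [expec]
  field_simp
  rw [key, sum_mul]
  exact sum_congr rfl fun c _ => by ring

/-! ### Indicators of monochromatic edge sets -/

open Classical in
/-- The indicator that all edges of `U` have the same color. -/
noncomputable def monoInd {n : ℕ} (U : Finset (EdgeOf n)) (c : EdgeColoring n) : ℝ :=
  if ∃ b : Bool, ∀ e ∈ U, c e = b then 1 else 0

/-- The edges with both ends in `S`. -/
def edgesIn {n : ℕ} (S : Finset (Fin n)) : Finset (EdgeOf n) :=
  univ.filter fun e => (e : Finset (Fin n)) ⊆ S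

lemma mem_edgesIn {n : ℕ} {S : Finset (Fin n)} {e : EdgeOf n} :
    e ∈ edgesIn S ↔ (e : Finset (Fin n)) ⊆ S := by
  simp [edgesIn]

lemma card_edgesIn {n : ℕ} (S : Finset (Fin n)) : #(edgesIn S) = (#S).choose 2 := by
  rw [← card_powersetCard, ← card_map (Function.Embedding.subtype _)]
  congr 1
  ext e
  simp only [mem_map, mem_edgesIn, mem_powersetCard, Function.Embedding.subtype_apply]
  constructor
  · rintro ⟨a, ha, rfl⟩
    exact ⟨ha, a.2⟩
  · rintro ⟨h1, h2⟩
    exact ⟨⟨e, h2⟩, h1, rfl⟩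

lemma edgesIn_inter {n : ℕ} (S T : Finset (Fin n)) :
    edgesIn S ∩ edgesIn T = edgesIn (S ∩ T) := by
  ext e
  simp only [mem_inter, mem_edgesIn, subset_inter_iff]

lemma monoInd_nonneg {n : ℕ} (U : Finset (EdgeOf n)) (c : EdgeColoring n) : 0 ≤ monoInd U c := by
  unfold monoInd
  split_ifs <;> norm_num

lemma monoInd_le_one {n : ℕ} (U : Finset (EdgeOf n)) (c : EdgeColoring n) : monoInd U c ≤ 1 := by
  unfold monoInd
  split_ifs <;> norm_num

lemma dependsOn_monoInd {n : ℕ} (U : Finset (EdgeOf n)) : DependsOn (monoInd U) (U : Set _) := by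
  intro c d h
  have : (∃ b : Bool, ∀ e ∈ U, c e = b) ↔ ∃ b : Bool, ∀ e ∈ U, d e = b :=
    exists_congr fun b => forall₂_congr fun e he => by rw [h e he]
  simp only [monoInd, this]

lemma monoCount_eq_sum (n k : ℕ) (c : EdgeColoring n) :
    (monoCount n k c : ℝ) = ∑ S ∈ univ.powersetCard k, monoInd (edgesIn S) c := by
  classical
  simp only [monoCount, monoInd, mem_edgesIn, sum_boole]

lemma card_filter_forall_eq {n : ℕ} (U : Finset (EdgeOf n)) (b : Bool) :
    #{c : EdgeColoring n | ∀ e ∈ U, c e = b} * 2 ^ #U = Fintype.card (EdgeColoring n) := by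
  classical
  have : ({c : EdgeColoring n | ∀ e ∈ U, c e = b} : Finset _)
      = Fintype.piFinset fun e => if e ∈ U then {b} else univ := by
    ext c
    simp only [mem_filter, mem_univ, true_and, Fintype.mem_piFinset]
    refine forall_congr' fun e => ?_
    by_cases he : e ∈ U <;> simp [he]
  have hU : (2 : ℕ) ^ #U = ∏ e, if e ∈ U then 2 else 1 := by
    rw [prod_ite_mem, univ_inter, prod_const]
  rw [this, Fintype.card_piFinset, hU, ← prod_mul_distrib, Fintype.card_fun, Fintype.card_bool,
    ← card_univ, ← prod_const]
  exact prod_congr rfl fun e _ => by by_cases he : e ∈ U <;> simp [he]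

lemma expec_monoInd {n : ℕ} {U : Finset (EdgeOf n)} (hU : U.Nonempty) :
    expec n (monoInd U) = 2 / 2 ^ #U := by
  classical
  have h : ∀ c, monoInd U c = (if ∀ e ∈ U, c e = true then 1 else 0)
      + (if ∀ e ∈ U, c e = false then (1 : ℝ) else 0) := by
    intro c
    obtain ⟨e, he⟩ := hU
    have hnot : ¬((∀ e ∈ U, c e = true) ∧ ∀ e ∈ U, c e = false) := fun h => by
      simpa [h.1 e he] using h.2 e he
    simp only [monoInd, Bool.exists_bool]
    by_cases h1 : ∀ e ∈ U, c e = true <;> by_cases h2 : ∀ e ∈ U, c e = false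
    · exact absurd ⟨h1, h2⟩ hnot
    all_goals simp only [h1, h2, if_false, or_false, false_or, or_self, add_zero, zero_add]
  have hc := fun b => congrArg (Nat.cast (R := ℝ)) (card_filter_forall_eq U b)
  push_cast at hc
  have hpos := card_edgeColoring_pos n
  simp only [expec, h, sum_add_distrib, sum_boole]
  rw [div_eq_div_iff hpos.ne' (by positivity), add_mul, hc, hc]
  ring

/-- The event that `U` is monochromatic is independent of any function whose edges meet `U`
in at most one edge. -/
lemma expec_monoInd_mul {n : ℕ} {U : Finset (EdgeOf n)} {B : Set (EdgeOf n)} {e₀ : EdgeOf n}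
    (he₀ : e₀ ∈ U) (hB : ∀ e ∈ U, e ∈ B → e = e₀) {g : EdgeColoring n → ℝ} (hg : DependsOn g B) :
    expec n (fun c => monoInd U c * g c) = expec n (monoInd U) * expec n g := by
  classical
  let φ : EdgeColoring n ≃ EdgeColoring n :=
    Function.Involutive.toPerm
      (fun c e => if e ∈ U.erase e₀ then xor (c e) (c e₀) else c e) (by
        intro c
        ext e
        by_cases he : e ∈ U.erase e₀ <;> simp [he])
  have hφ : ∀ c e, φ c e = if e ∈ U.erase e₀ then xor (c e) (c e₀) else c e := fun _ _ => rfl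
  let J : EdgeColoring n → ℝ := fun c => if ∀ e ∈ U.erase e₀, c e = false then 1 else 0
  have hJ : DependsOn J (U.erase e₀ : Set (EdgeOf n)) := by
    intro c d h
    have : (∀ e ∈ U.erase e₀, c e = false) ↔ ∀ e ∈ U.erase e₀, d e = false :=
      forall₂_congr fun e he => by rw [h e he]
    simp only [J, this]
  have hJφ : ∀ c, J (φ c) = monoInd U c := by
    intro c
    have : (∀ e ∈ U.erase e₀, φ c e = false) ↔ ∃ b : Bool, ∀ e ∈ U, c e = b := by
      constructor
      · intro h
        refine ⟨c e₀, fun e he => ?_⟩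
        by_cases hee : e = e₀
        · rw [hee]
        · have he' := mem_erase.2 ⟨hee, he⟩
          have := h e he'
          rw [hφ, if_pos he'] at this
          simpa using this
      · rintro ⟨b, hb⟩ e he
        rw [hφ, if_pos he, hb e (mem_of_mem_erase he), hb e₀ he₀, Bool.xor_self]
    simp only [J, monoInd, this]
  have hgφ : ∀ c, g (φ c) = g c := fun c => hg fun e he => by
    rw [hφ, if_neg]
    intro h
    exact (mem_erase.1 h).1 (hB e (mem_of_mem_erase h) he)
  have hdisj : Disjoint (U.erase e₀ : Set (EdgeOf n)) B := by
    rw [Set.disjoint_left]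
    intro e he heB
    have he' := mem_erase.1 (mem_coe.1 he)
    exact he'.1 (hB e he'.2 heB)
  have h1 : expec n (monoInd U) = expec n J := by
    rw [← expec_comp_equiv n φ J]
    simp only [hJφ]
  rw [h1, ← expec_mul_of_dependsOn n hdisj hJ hg,
    ← expec_comp_equiv n φ (fun c => J c * g c)]
  simp only [hJφ, hgφ]

/-! ### Centered clique indicators -/

/-- The centered indicator that `S` spans a monochromatic clique. -/
noncomputable def centered {n : ℕ} (S : Finset (Fin n)) (c : EdgeColoring n) : ℝ :=
  monoInd (edgesIn S) c - expec n (monoInd (edgesIn S))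

lemma dependsOn_centered {n : ℕ} (S : Finset (Fin n)) :
    DependsOn (centered S) (edgesIn S : Set (EdgeOf n)) := fun c d h => by
  rw [centered, centered, dependsOn_monoInd _ h]

lemma abs_centered_le_one {n : ℕ} (S : Finset (Fin n)) (c : EdgeColoring n) :
    |centered S c| ≤ 1 := by
  have h1 := monoInd_nonneg (edgesIn S) c
  have h2 := monoInd_le_one (edgesIn S) c
  have h3 := expec_mono n (f := fun _ => (0 : ℝ)) (monoInd_nonneg (edgesIn S))
  have h4 := expec_mono n (g := fun _ => (1 : ℝ)) (monoInd_le_one (edgesIn S))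
  rw [expec_const] at h3 h4
  rw [centered, abs_le]
  constructor <;> linarith

lemma monoCount_sub_expec (n k : ℕ) (c : EdgeColoring n) :
    (monoCount n k c : ℝ) - expec n (fun c' => (monoCount n k c' : ℝ))
      = ∑ S ∈ univ.powersetCard k, centered S c := by
  simp only [monoCount_eq_sum, expec_sum, centered, sum_sub_distrib]

lemma abs_prod_centered_le_one {n : ℕ} {ι : Type*} (s : Finset ι) (S : ι → Finset (Fin n))
    (c : EdgeColoring n) : |∏ i ∈ s, centered (S i) c| ≤ 1 := by
  rw [abs_prod]
  exact prod_le_one (fun _ _ => abs_nonneg _) fun _ _ => abs_centered_le_one _ _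

lemma dependsOn_prod_centered {n : ℕ} {ι : Type*} (s : Finset ι) (S : ι → Finset (Fin n)) :
    DependsOn (fun c => ∏ i ∈ s, centered (S i) c)
      {e : EdgeOf n | ∃ i ∈ s, (e : Finset (Fin n)) ⊆ S i} := fun _ _ h =>
  prod_congr rfl fun i hi => dependsOn_centered (S i) fun e he =>
    h e ⟨i, hi, mem_edgesIn.1 he⟩

lemma expec_centered_mul_eq_zero {n : ℕ} {S e₀ : Finset (Fin n)} (he₀ : e₀ ⊆ S) (h2 : #e₀ = 2)
    {B : Set (EdgeOf n)} (hB : ∀ e ∈ B, (e : Finset (Fin n)) ⊆ S → (e : Finset (Fin n)) = e₀)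
    {g : EdgeColoring n → ℝ} (hg : DependsOn g B) :
    expec n (fun c => centered S c * g c) = 0 := by
  have := expec_monoInd_mul (U := edgesIn S) (e₀ := ⟨e₀, h2⟩) (mem_edgesIn.2 he₀)
    (fun e he heB => Subtype.ext (hB e heB (mem_edgesIn.1 he))) hg
  simp only [centered, sub_mul, expec_sub, expec_const_mul, this, sub_self]

/-- The product has mean zero as soon as one clique shares at most one edge with the others. -/
lemma expec_prod_centered_eq_zero {n : ℕ} {ι : Type*} [DecidableEq ι] {s : Finset ι}
    {S : ι → Finset (Fin n)} {i : ι} (hi : i ∈ s) {e₀ : Finset (Fin n)} (he₀ : e₀ ⊆ S i)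
    (h2 : #e₀ = 2)
    (h : ∀ j ∈ s, j ≠ i → ∀ e ⊆ S i ∩ S j, #e = 2 → e = e₀) :
    expec n (fun c => ∏ j ∈ s, centered (S j) c) = 0 := by
  simp only [← mul_prod_erase s _ hi]
  refine expec_centered_mul_eq_zero he₀ h2 ?_ (dependsOn_prod_centered (s.erase i) S)
  rintro e ⟨j, hj, hej⟩ hei
  exact h j (mem_of_mem_erase hj) (ne_of_mem_erase hj) e (subset_inter hei hej) e.2

/-! ### Overlaps of families of cliques -/

/-- The elements of `S i` lying in some other member of the family. -/
def overlap {V ι : Type*} [DecidableEq V] [Fintype ι] [DecidableEq ι] (S : ι → Finset V) (i : ι) :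
    Finset V :=
  (S i).filter fun v => ∃ j, j ≠ i ∧ v ∈ S j

section Overlap

variable {V ι : Type*} [DecidableEq V] [Fintype ι]

lemma mem_overlap [DecidableEq ι] {S : ι → Finset V} {i : ι} {v : V} :
    v ∈ overlap S i ↔ v ∈ S i ∧ ∃ j, j ≠ i ∧ v ∈ S j := by
  simp [overlap]

lemma overlap_subset [DecidableEq ι] (S : ι → Finset V) (i : ι) : overlap S i ⊆ S i :=
  filter_subset _ _

lemma inter_subset_overlap [DecidableEq ι] (S : ι → Finset V) {i j : ι} (h : j ≠ i) :
    S i ∩ S j ⊆ overlap S i := fun _ hv =>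
  mem_overlap.2 ⟨(mem_inter.1 hv).1, j, h, (mem_inter.1 hv).2⟩

/-- The number of members of the family containing `v`. -/
def coverCount (S : ι → Finset V) (v : V) : ℕ := #{i | v ∈ S i}

lemma mem_overlap_iff_two_le [DecidableEq ι] {S : ι → Finset V} {i : ι} {v : V} (hi : v ∈ S i) :
    v ∈ overlap S i ↔ 2 ≤ coverCount S v := by
  have hmem : i ∈ ({i | v ∈ S i} : Finset ι) := by simpa using hi
  rw [mem_overlap, coverCount, Nat.succ_le_iff, one_lt_card_iff_nontrivial]
  constructor
  · rintro ⟨-, j, hj, hvj⟩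
    exact ⟨i, hmem, j, by simpa using hvj, hj.symm⟩
  · intro h
    obtain ⟨j, hj, hji⟩ := h.exists_ne i
    exact ⟨hi, j, hji, by simpa using hj⟩

lemma sum_card_filter_eq (S : ι → Finset V) (P : V → Prop) [DecidablePred P] :
    ∑ i, #{v ∈ S i | P v} = ∑ v ∈ univ.biUnion S, if P v then coverCount S v else 0 := by
  have h : ∀ i, #{v ∈ S i | P v}
      = ∑ v ∈ univ.biUnion S, if v ∈ S i then (if P v then 1 else 0) else 0 := by
    intro i
    rw [card_filter, sum_ite_mem, inter_eq_right.2 (subset_biUnion_of_mem S (mem_univ i))]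
  simp only [h]
  rw [sum_comm]
  refine sum_congr rfl fun v _ => ?_
  split_ifs <;> simp [coverCount]

lemma two_mul_card_biUnion_add_le [DecidableEq ι] (S : ι → Finset V) :
    2 * #(univ.biUnion S) + ∑ i, #(overlap S i)
      + ∑ v ∈ univ.biUnion S, (coverCount S v - 2) ≤ 2 * ∑ i, #(S i) := by
  have h : ∑ i, #(overlap S i)
      = ∑ v ∈ univ.biUnion S, if 2 ≤ coverCount S v then coverCount S v else 0 := by
    rw [← sum_card_filter_eq]
    refine sum_congr rfl fun i _ => congrArg card ?_
    ext v
    rw [mem_filter]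
    exact ⟨fun hv => ⟨overlap_subset S i hv, (mem_overlap_iff_two_le (overlap_subset S i hv)).1 hv⟩,
      fun hv => (mem_overlap_iff_two_le hv.1).2 hv.2⟩
  have h' : ∑ i, #(S i) = ∑ v ∈ univ.biUnion S, coverCount S v := by
    simpa using sum_card_filter_eq S fun _ => True
  rw [h, h', mul_comm 2 #_, card_eq_sum_ones, sum_mul, mul_sum,
    ← sum_add_distrib, ← sum_add_distrib]
  refine sum_le_sum fun v hv => ?_
  have : 1 ≤ coverCount S v := by
    obtain ⟨i, -, hi⟩ := mem_biUnion.1 hv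
    exact card_pos.2 ⟨i, by simpa using hi⟩
  split_ifs <;> omega

end Overlap

/-! ### Which families contribute to the moments -/

section Contribution

variable {n k : ℕ} {ι : Type*} [Fintype ι] [DecidableEq ι] {S : ι → Finset (Fin n)}

lemma three_le_card_overlap (hk : 2 ≤ k) (hS : ∀ i, #(S i) = k)
    (h : expec n (fun c => ∏ i, centered (S i) c) ≠ 0) (i : ι) : 3 ≤ #(overlap S i) := by
  by_contra! hlt
  obtain ⟨e₀, h1, h2, h3⟩ := exists_subsuperset_card_eq (overlap_subset S i)
    (Nat.le_of_lt_succ hlt) (hk.trans_eq (hS i).symm)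
  refine h (expec_prod_centered_eq_zero (mem_univ i) h2 h3 fun j _ hj e he hcard => ?_)
  exact eq_of_subset_of_card_le ((he.trans (inter_subset_overlap S hj)).trans h1) (by omega)

lemma two_mul_card_biUnion_add_three_mul_le (hk : 2 ≤ k) (hS : ∀ i, #(S i) = k)
    (h : expec n (fun c => ∏ i, centered (S i) c) ≠ 0) :
    2 * #(univ.biUnion S) + 3 * Fintype.card ι ≤ 2 * k * Fintype.card ι := by
  have h1 := two_mul_card_biUnion_add_le S
  have h0 := Nat.zero_le (∑ v ∈ univ.biUnion S, (coverCount S v - 2))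
  have h2 : ∑ _i : ι, 3 ≤ ∑ i, #(overlap S i) :=
    sum_le_sum fun i _ => three_le_card_overlap hk hS h i
  simp only [hS, sum_const, card_univ, smul_eq_mul] at h1 h2
  linarith

/-- A contributing family of extremal size splits into pairs, each disjoint from the rest. -/
lemma exists_pair_of_extremal (hk : 2 ≤ k) (hS : ∀ i, #(S i) = k)
    (h : expec n (fun c => ∏ i, centered (S i) c) ≠ 0)
    (hext : 2 * k * Fintype.card ι ≤ 2 * #(univ.biUnion S) + 3 * Fintype.card ι) (i : ι) :
    ∃ j ≠ i, ∀ l, l ≠ i → l ≠ j → Disjoint (S i) (S l) ∧ Disjoint (S j) (S l) := by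
  have hthree := three_le_card_overlap hk hS h
  have h1 := two_mul_card_biUnion_add_le S
  have h0 := Nat.zero_le (∑ v ∈ univ.biUnion S, (coverCount S v - 2))
  have h2 : ∑ _i : ι, 3 ≤ ∑ i, #(overlap S i) := sum_le_sum fun i _ => hthree i
  have h3 : ∑ i : ι, 3 = ∑ i, #(overlap S i) := by
    refine le_antisymm h2 ?_
    simp only [hS, sum_const, card_univ, smul_eq_mul] at h1 h2 ⊢
    linarith
  have h4 : ∑ v ∈ univ.biUnion S, (coverCount S v - 2) = 0 := by
    simp only [hS, sum_const, card_univ, smul_eq_mul] at h1 h2 ⊢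
    linarith
  have hcard : ∀ i, #(overlap S i) = 3 := fun i =>
    ((sum_eq_sum_iff_of_le fun i _ => hthree i).1 h3 i (mem_univ i)).symm
  have hcover : ∀ v a b d, a ≠ b → a ≠ d → b ≠ d → v ∈ S a → v ∈ S b → v ∈ S d → False := by
    intro v a b d hab had hbd ha hb hd
    have hle := sum_eq_zero_iff.1 h4 v (mem_biUnion.2 ⟨a, mem_univ a, ha⟩)
    have : 3 ≤ coverCount S v := by
      rw [coverCount, ← card_eq_three.2 ⟨a, b, d, hab, had, hbd, rfl⟩]
      refine card_le_card fun l hl => ?_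
      simp only [mem_insert, mem_singleton] at hl
      rcases hl with rfl | rfl | rfl <;> simpa
    omega
  have hpair : ∃ j ≠ i, 3 ≤ #(S i ∩ S j) := by
    by_contra! hlt
    obtain ⟨e₀, he₀, h2, huniq⟩ : ∃ e₀ ⊆ S i, #e₀ = 2 ∧
        ∀ j, j ≠ i → ∀ e ⊆ S i ∩ S j, #e = 2 → e = e₀ := by
      by_cases hex : ∃ j ≠ i, #(S i ∩ S j) = 2
      · obtain ⟨j, hj, hj2⟩ := hex
        refine ⟨S i ∩ S j, inter_subset_left, hj2, fun l hl e he hcard2 => ?_⟩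
        by_cases hlj : l = j
        · subst hlj
          exact eq_of_subset_of_card_le he (by omega)
        · exfalso
          have hdisj : Disjoint (S i ∩ S j) e := by
            rw [disjoint_left]
            intro v hv hve
            have hvl := mem_inter.1 (he hve)
            exact hcover v i j l hj.symm hl.symm (Ne.symm hlj) hvl.1 (mem_inter.1 hv).2 hvl.2
          have hsub := card_le_card (union_subset (inter_subset_overlap S hj)
            (he.trans (inter_subset_overlap S hl)))
          rw [card_union_of_disjoint hdisj, hcard i] at hsub
          omega
      · push Not at hex
        obtain ⟨e₀, h1, h2⟩ := exists_subset_card_eq (hk.trans_eq (hS i).symm)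
        refine ⟨e₀, h1, h2, fun j hj e he hcard2 => ?_⟩
        have h5 := card_le_card he
        have h6 := hlt j hj
        have h7 := hex j hj
        omega
    exact h (expec_prod_centered_eq_zero (mem_univ i) he₀ h2 fun j _ => huniq j)
  obtain ⟨j, hj, hj3⟩ := hpair
  have hi : S i ∩ S j = overlap S i :=
    eq_of_subset_of_card_le (inter_subset_overlap S hj) (by rw [hcard i]; exact hj3)
  have hj' : S j ∩ S i = overlap S j :=
    eq_of_subset_of_card_le (inter_subset_overlap S hj.symm)
      (by rw [hcard j, inter_comm]; exact hj3)
  refine ⟨j, hj, fun l hli hlj => ⟨?_, ?_⟩⟩ <;> rw [disjoint_left] <;> intro v hv hvl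
  · have hvj := inter_subset_overlap S hli (mem_inter.2 ⟨hv, hvl⟩)
    rw [← hi, mem_inter] at hvj
    exact hcover v i j l hj.symm hli.symm hlj.symm hv hvj.2 hvl
  · have hvi := inter_subset_overlap S hlj (mem_inter.2 ⟨hv, hvl⟩)
    rw [← hj', mem_inter] at hvi
    exact hcover v i j l hj.symm hli.symm hlj.symm hvi.2 hv hvl

end Contribution

/-! ### The fourth moment -/

/-- The covariance of two centered clique indicators. -/
noncomputable def cliqueCov {n : ℕ} (a b : Finset (Fin n)) : ℝ :=
  expec n (fun c => centered a c * centered b c)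

/-- The difference between a fourth mixed moment and its Gaussian (Wick) prediction. -/
noncomputable def wickDefect {n : ℕ} (a b c d : Finset (Fin n)) : ℝ :=
  expec n (fun x => centered a x * centered b x * centered c x * centered d x)
    - (cliqueCov a b * cliqueCov c d + cliqueCov a c * cliqueCov b d
      + cliqueCov a d * cliqueCov b c)

section FourthMoment

variable {n k : ℕ} {a b c d : Finset (Fin n)}

lemma cliqueCov_comm (a b : Finset (Fin n)) : cliqueCov a b = cliqueCov b a := by
  simp only [cliqueCov, mul_comm]

lemma wickDefect_swap_middle (a b c d : Finset (Fin n)) :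
    wickDefect a c b d = wickDefect a b c d := by
  have : ∀ x, centered a x * centered c x * centered b x * centered d x
      = centered a x * centered b x * centered c x * centered d x := fun x => by ring
  simp only [wickDefect, this, cliqueCov_comm c b]
  ring

lemma wickDefect_swap_right (a b c d : Finset (Fin n)) :
    wickDefect a b d c = wickDefect a b c d := by
  have : ∀ x, centered a x * centered b x * centered d x * centered c x
      = centered a x * centered b x * centered c x * centered d x := fun x => by ring
  simp only [wickDefect, this, cliqueCov_comm d c]
  ring

lemma abs_cliqueCov_le_one (a b : Finset (Fin n)) : |cliqueCov a b| ≤ 1 :=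
  abs_expec_le_one n fun c => by
    rw [abs_mul]
    exact mul_le_one₀ (abs_centered_le_one a c) (abs_nonneg _) (abs_centered_le_one b c)

lemma abs_wickDefect_le (a b c d : Finset (Fin n)) : |wickDefect a b c d| ≤ 4 := by
  have h4 : |expec n fun x => centered a x * centered b x * centered c x * centered d x| ≤ 1 :=
    abs_expec_le_one n fun x => by
      simpa [Fin.prod_univ_four] using abs_prod_centered_le_one univ ![a, b, c, d] x
  have h2 : ∀ a b c d : Finset (Fin n), |cliqueCov a b * cliqueCov c d| ≤ 1 := fun a b c d => by
    rw [abs_mul]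
    exact mul_le_one₀ (abs_cliqueCov_le_one a b) (abs_nonneg _) (abs_cliqueCov_le_one c d)
  have h5 := abs_le.1 (h2 a b c d)
  have h6 := abs_le.1 (h2 a c b d)
  have h7 := abs_le.1 (h2 a d b c)
  have h8 := abs_le.1 h4
  rw [wickDefect, abs_le]
  constructor <;> linarith

lemma cliqueCov_eq_zero (ha : 2 ≤ #a) (h : #(a ∩ b) ≤ 2) : cliqueCov a b = 0 := by
  obtain ⟨e₀, h1, h2, h3⟩ := exists_subsuperset_card_eq inter_subset_left h ha
  refine expec_centered_mul_eq_zero h2 h3 (fun e he hea => ?_) (dependsOn_centered b)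
  refine eq_of_subset_of_card_le ((subset_inter hea ?_).trans h1) (by rw [h3, e.2])
  exact mem_edgesIn.1 (mem_coe.1 he)

lemma wickDefect_eq_zero_of_disjoint (ha : 2 ≤ #a) (h : Disjoint (a ∪ b) (c ∪ d)) :
    wickDefect a b c d = 0 := by
  have hac : cliqueCov a c = 0 := cliqueCov_eq_zero ha (by
    rw [disjoint_iff_inter_eq_empty.1 (h.mono subset_union_left subset_union_left)]; simp)
  have had : cliqueCov a d = 0 := cliqueCov_eq_zero ha (by
    rw [disjoint_iff_inter_eq_empty.1 (h.mono subset_union_left subset_union_right)]; simp)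
  have hdep : ∀ s t : Finset (Fin n), DependsOn (fun x => centered s x * centered t x)
      (edgesIn (s ∪ t) : Set (EdgeOf n)) := fun s t x y hxy => by
    have hs : centered s x = centered s y := dependsOn_centered s fun e he =>
      hxy e (mem_edgesIn.2 ((mem_edgesIn.1 he).trans subset_union_left))
    have ht : centered t x = centered t y := dependsOn_centered t fun e he =>
      hxy e (mem_edgesIn.2 ((mem_edgesIn.1 he).trans subset_union_right))
    simp only [hs, ht]
  have hdisj : Disjoint (edgesIn (a ∪ b) : Set (EdgeOf n)) (edgesIn (c ∪ d)) := by
    rw [Set.disjoint_left]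
    intro e he he'
    have h0 := disjoint_self_iff_empty _ |>.1
      (h.mono (mem_edgesIn.1 (mem_coe.1 he)) (mem_edgesIn.1 (mem_coe.1 he')))
    have h2 := e.2
    rw [h0] at h2
    simp at h2
  have := expec_mul_of_dependsOn n hdisj (hdep a b) (hdep c d)
  simp only [wickDefect, mul_assoc, hac, had] at this ⊢
  rw [this]
  simp [cliqueCov]

lemma disjoint_of_cliqueCov_mul_ne_zero (hk : 2 ≤ k) (ha : #a = k) (hb : #b = k) (hc : #c = k)
    (hd : #d = k) (hu : 4 * k ≤ #(a ∪ b ∪ (c ∪ d)) + 6)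
    (h : cliqueCov a b * cliqueCov c d ≠ 0) : Disjoint (a ∪ b) (c ∪ d) := by
  have h1 : 3 ≤ #(a ∩ b) := by
    by_contra! hlt
    exact h (by rw [cliqueCov_eq_zero (by omega) (Nat.le_of_lt_succ hlt), zero_mul])
  have h2 : 3 ≤ #(c ∩ d) := by
    by_contra! hlt
    exact h (by rw [cliqueCov_eq_zero (a := c) (by omega) (Nat.le_of_lt_succ hlt), mul_zero])
  have h3 := card_union_add_card_inter a b
  have h4 := card_union_add_card_inter c d
  have h5 := card_union_add_card_inter (a ∪ b) (c ∪ d)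
  rw [disjoint_iff_inter_eq_empty, ← card_eq_zero]
  omega

lemma wickDefect_eq_zero (hk : 2 ≤ k) (ha : #a = k) (hb : #b = k) (hc : #c = k)
    (hd : #d = k) (hu : 4 * k ≤ #(a ∪ b ∪ (c ∪ d)) + 6) : wickDefect a b c d = 0 := by
  have ha2 : 2 ≤ #a := ha ▸ hk
  have hu' : a ∪ c ∪ (b ∪ d) = a ∪ b ∪ (c ∪ d) := by
    ext v; simp only [mem_union]; tauto
  have hu'' : a ∪ d ∪ (b ∪ c) = a ∪ b ∪ (c ∪ d) := by
    ext v; simp only [mem_union]; tauto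
  have key : Disjoint (a ∪ b) (c ∪ d) ∨ Disjoint (a ∪ c) (b ∪ d) ∨ Disjoint (a ∪ d) (b ∪ c) →
      wickDefect a b c d = 0 := by
    rintro (h | h | h)
    · exact wickDefect_eq_zero_of_disjoint ha2 h
    · rw [← wickDefect_swap_middle]
      exact wickDefect_eq_zero_of_disjoint ha2 h
    · rw [← wickDefect_swap_right, ← wickDefect_swap_middle]
      exact wickDefect_eq_zero_of_disjoint ha2 h
  by_contra hne
  by_cases h4 : expec n (fun x => centered a x * centered b x * centered c x * centered d x) = 0
  · have h1 : cliqueCov a b * cliqueCov c d = 0 := by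
      by_contra h
      exact hne (key (.inl (disjoint_of_cliqueCov_mul_ne_zero hk ha hb hc hd hu h)))
    have h2 : cliqueCov a c * cliqueCov b d = 0 := by
      by_contra h
      exact hne (key (.inr (.inl
        (disjoint_of_cliqueCov_mul_ne_zero hk ha hc hb hd (hu' ▸ hu) h))))
    have h3 : cliqueCov a d * cliqueCov b c = 0 := by
      by_contra h
      exact hne (key (.inr (.inr
        (disjoint_of_cliqueCov_mul_ne_zero hk ha hd hb hc (hu'' ▸ hu) h))))
    exact hne (by rw [wickDefect, h1, h2, h3, h4]; norm_num)
  · have hS : ∀ i, #((![a, b, c, d] : Fin 4 → Finset (Fin n)) i) = k := by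
      intro i
      fin_cases i <;> assumption
    have hU : univ.biUnion (![a, b, c, d] : Fin 4 → Finset (Fin n)) = a ∪ b ∪ (c ∪ d) := by
      ext v
      simp [Fin.exists_fin_succ]
    obtain ⟨j, hj, hdisj⟩ := exists_pair_of_extremal (S := ![a, b, c, d]) hk hS
      (by simpa [Fin.prod_univ_four] using h4) (by rw [hU, Fintype.card_fin]; omega) 0
    apply hne ∘ key
    simp only [disjoint_union_left, disjoint_union_right]
    fin_cases j
    · exact absurd rfl hj
    · have h2 := hdisj 2 (by decide) (by decide)
      have h3 := hdisj 3 (by decide) (by decide)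
      exact .inl ⟨h2, h3⟩
    · have h1 := hdisj 1 (by decide) (by decide)
      have h3 := hdisj 3 (by decide) (by decide)
      exact .inr (.inl ⟨h1, h3⟩)
    · have h1 := hdisj 1 (by decide) (by decide)
      have h2 := hdisj 2 (by decide) (by decide)
      exact .inr (.inr ⟨h1, h2⟩)

end FourthMoment

/-! ### Upper bounds for the moments -/

lemma card_filter_biUnion_le (n m u : ℕ) (hu : u ≤ n) :
    #{S : Fin m → Finset (Fin n) | #(univ.biUnion S) ≤ u} ≤ 2 ^ (u * m) * n ^ u := by
  have hsub : ({S : Fin m → Finset (Fin n) | #(univ.biUnion S) ≤ u} : Finset _)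
      ⊆ (univ.powersetCard u).biUnion fun A => Fintype.piFinset fun _ => A.powerset := by
    intro S hS
    obtain ⟨A, hA, hcard⟩ := exists_superset_card_eq (mem_filter.1 hS).2 (by simpa using hu)
    simp only [mem_biUnion, mem_powersetCard, Fintype.mem_piFinset, mem_powerset]
    exact ⟨A, ⟨subset_univ A, hcard⟩, fun i => (subset_biUnion_of_mem S (mem_univ i)).trans hA⟩
  refine (card_le_card hsub).trans (card_biUnion_le.trans ?_)
  have : ∀ A ∈ (univ : Finset (Fin n)).powersetCard u,
      #(Fintype.piFinset fun _ : Fin m => A.powerset) = 2 ^ (u * m) := by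
    intro A hA
    simp [(mem_powersetCard.1 hA).2, pow_mul]
  rw [sum_congr rfl this, sum_const, card_powersetCard, card_univ, Fintype.card_fin, smul_eq_mul,
    mul_comm]
  exact Nat.mul_le_mul_left _ (Nat.choose_le_pow n u)

/-- A sum over families of `k`-sets whose terms vanish unless the union has size at most `u`. -/
lemma abs_sum_families_le {n k m u : ℕ} (hu : u ≤ n) {b : ℝ} (hb : 0 ≤ b)
    (F : (Fin m → Finset (Fin n)) → ℝ) (hF : ∀ S, |F S| ≤ b)
    (h0 : ∀ S : Fin m → Finset (Fin n), (∀ i, #(S i) = k) → u < #(univ.biUnion S) → F S = 0) :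
    |∑ S ∈ Fintype.piFinset fun _ : Fin m => univ.powersetCard k, F S|
      ≤ b * 2 ^ (u * m) * (n : ℝ) ^ u := by
  calc |∑ S ∈ Fintype.piFinset fun _ : Fin m => univ.powersetCard k, F S|
      ≤ ∑ S ∈ Fintype.piFinset fun _ : Fin m => univ.powersetCard k, |F S| :=
        abs_sum_le_sum_abs _ _
    _ ≤ ∑ S ∈ Fintype.piFinset fun _ : Fin m => (univ : Finset (Fin n)).powersetCard k,
          if #(univ.biUnion S) ≤ u then b else 0 := by
        refine sum_le_sum fun S hS => ?_
        split_ifs with h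
        · exact hF S
        · rw [h0 S (fun i => (mem_powersetCard.1 (Fintype.mem_piFinset.1 hS i)).2) (not_le.1 h),
            abs_zero]
    _ ≤ ∑ S : Fin m → Finset (Fin n), if #(univ.biUnion S) ≤ u then b else 0 :=
        sum_le_sum_of_subset_of_nonneg (subset_univ _) fun _ _ _ => by split_ifs <;> simp [hb]
    _ = #{S : Fin m → Finset (Fin n) | #(univ.biUnion S) ≤ u} * b := by
        rw [← sum_filter, sum_const, nsmul_eq_mul]
    _ ≤ (2 ^ (u * m) * n ^ u : ℕ) * b :=
        mul_le_mul_of_nonneg_right (by exact_mod_cast card_filter_biUnion_le n m u hu) hb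
    _ = b * 2 ^ (u * m) * (n : ℝ) ^ u := by
        push_cast
        ring

lemma centralMoment_eq_sum (n k m : ℕ) :
    centralMoment n k m = ∑ S ∈ Fintype.piFinset fun _ : Fin m => univ.powersetCard k,
      expec n (fun c => ∏ i, centered (S i) c) := by
  rw [← expec_sum]
  simp only [centralMoment, monoCount_sub_expec]
  congr 1
  ext c
  have := prod_univ_sum (fun _ : Fin m => (univ : Finset (Fin n)).powersetCard k)
    fun _ s => centered s c
  rwa [prod_const, card_univ, Fintype.card_fin] at this

lemma abs_centralMoment_le {n k m u : ℕ} (hk : 2 ≤ k) (hu : u ≤ n)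
    (hm : 2 * k * m < 2 * u + 2 + 3 * m) :
    |centralMoment n k m| ≤ 2 ^ (u * m) * (n : ℝ) ^ u := by
  rw [centralMoment_eq_sum]
  refine (abs_sum_families_le hu zero_le_one _
    (fun S => abs_expec_le_one n fun c => abs_prod_centered_le_one _ S c) ?_).trans_eq
    (by rw [one_mul])
  intro S hS hlt
  by_contra h
  have := two_mul_card_biUnion_add_three_mul_le hk hS h
  rw [Fintype.card_fin] at this
  omega

lemma centralMoment_two_eq_sum (n k : ℕ) :
    centralMoment n k 2
      = ∑ a ∈ univ.powersetCard k, ∑ b ∈ univ.powersetCard k, cliqueCov (n := n) a b := by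
  simp only [centralMoment, monoCount_sub_expec, cliqueCov, ← expec_sum, sq, sum_mul_sum]

/-- Ordered quadruples of `k`-sets, as an iterated sum. -/
lemma sum_piFinset_four {n k : ℕ} (f : Fin 4 → Finset (Fin n) → ℝ) :
    ∑ S ∈ Fintype.piFinset fun _ : Fin 4 => univ.powersetCard k,
      f 0 (S 0) * f 1 (S 1) * f 2 (S 2) * f 3 (S 3)
      = (∑ a ∈ univ.powersetCard k, f 0 a) * (∑ a ∈ univ.powersetCard k, f 1 a)
        * (∑ a ∈ univ.powersetCard k, f 2 a) * (∑ a ∈ univ.powersetCard k, f 3 a) := by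
  have := prod_univ_sum (fun _ : Fin 4 => (univ : Finset (Fin n)).powersetCard k) f
  simpa only [Fin.prod_univ_four] using this.symm

lemma expec_mul_expec (n : ℕ) (f g : EdgeColoring n → ℝ) :
    expec n f * expec n g = expec n fun x => expec n fun y => f x * g y := by
  simp only [expec_const_mul]
  simp only [mul_comm _ (expec n g), expec_const_mul]

lemma sum_cliqueCov_mul (n k : ℕ) {i j l m : Fin 4}
    (f : EdgeColoring n → EdgeColoring n → Fin 4 → EdgeColoring n)
    (hf : ∀ x y, ∀ a : Fin 4, f x y a = if a = i ∨ a = j then x else y)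
    (hperm : ∀ g : Fin 4 → ℝ, g i * g j * (g l * g m) = g 0 * g 1 * g 2 * g 3)
    (hl : l ≠ i ∧ l ≠ j) (hm : m ≠ i ∧ m ≠ j) :
    ∑ S ∈ Fintype.piFinset fun _ : Fin 4 => (univ : Finset (Fin n)).powersetCard k,
      cliqueCov (S i) (S j) * cliqueCov (S l) (S m) = centralMoment n k 2 ^ 2 := by
  have h : ∀ S : Fin 4 → Finset (Fin n), cliqueCov (S i) (S j) * cliqueCov (S l) (S m)
      = expec n fun x => expec n fun y => centered (S 0) (f x y 0) * centered (S 1) (f x y 1)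
        * centered (S 2) (f x y 2) * centered (S 3) (f x y 3) := by
    intro S
    rw [cliqueCov, cliqueCov, expec_mul_expec]
    congr! 4 with x y
    rw [← hperm fun a => centered (S a) (f x y a)]
    simp only [hf, true_or, or_true, if_true, hl, hm, or_self, if_false]
  simp only [h, ← expec_sum]
  have hsum : ∀ x y, ∑ S ∈ Fintype.piFinset fun _ : Fin 4 => univ.powersetCard k,
      centered (S 0) (f x y 0) * centered (S 1) (f x y 1) * centered (S 2) (f x y 2)
        * centered (S 3) (f x y 3) = _ :=
    fun x y => sum_piFinset_four fun a s => centered s (f x y a)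
  simp only [hsum]
  rw [sq, centralMoment, expec_mul_expec]
  congr! 4 with x y
  rw [monoCount_sub_expec, monoCount_sub_expec,
    ← hperm fun a => ∑ s ∈ univ.powersetCard k, centered s (f x y a)]
  simp only [hf, true_or, or_true, if_true, hl, hm, or_self, if_false, sq]

lemma abs_centralMoment_four_sub_le {n k : ℕ} (hk : 2 ≤ k) (hn : 4 * k - 7 ≤ n) :
    |centralMoment n k 4 - 3 * centralMoment n k 2 ^ 2|
      ≤ 4 * 2 ^ ((4 * k - 7) * 4) * (n : ℝ) ^ (4 * k - 7) := by
  have h : centralMoment n k 4 - 3 * centralMoment n k 2 ^ 2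
      = ∑ S ∈ Fintype.piFinset fun _ : Fin 4 => (univ : Finset (Fin n)).powersetCard k,
        wickDefect (S 0) (S 1) (S 2) (S 3) := by
    simp only [wickDefect, sum_sub_distrib, sum_add_distrib]
    rw [sum_cliqueCov_mul n k (i := 0) (j := 1) (l := 2) (m := 3) _ (fun _ _ _ => rfl)
        (fun g => by ring) (by decide) (by decide),
      sum_cliqueCov_mul n k (i := 0) (j := 2) (l := 1) (m := 3) _ (fun _ _ _ => rfl)
        (fun g => by ring) (by decide) (by decide),
      sum_cliqueCov_mul n k (i := 0) (j := 3) (l := 1) (m := 2) _ (fun _ _ _ => rfl)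
        (fun g => by ring) (by decide) (by decide), centralMoment_eq_sum]
    simp only [Fin.prod_univ_four]
    ring
  rw [h]
  refine abs_sum_families_le hn (by norm_num) _ (fun S => abs_wickDefect_le _ _ _ _) ?_
  intro S hS hlt
  have hU : univ.biUnion S = S 0 ∪ S 1 ∪ (S 2 ∪ S 3) := by
    ext v
    simp [Fin.exists_fin_succ]
  rw [hU] at hlt
  exact wickDefect_eq_zero hk (hS 0) (hS 1) (hS 2) (hS 3) (by omega)

/-! ### A lower bound for the variance -/

lemma cliqueCov_eq_sub {n : ℕ} (a b : Finset (Fin n)) :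
    cliqueCov a b = expec n (fun c => monoInd (edgesIn a) c * monoInd (edgesIn b) c)
      - expec n (monoInd (edgesIn a)) * expec n (monoInd (edgesIn b)) := by
  have h : ∀ c, centered a c * centered b c = monoInd (edgesIn a) c * monoInd (edgesIn b) c
      - expec n (monoInd (edgesIn b)) * monoInd (edgesIn a) c
      - expec n (monoInd (edgesIn a)) * monoInd (edgesIn b) c
      + expec n (monoInd (edgesIn a)) * expec n (monoInd (edgesIn b)) := fun c => by
    simp only [centered]
    ring
  simp only [cliqueCov, h, expec_add, expec_sub, expec_const_mul, expec_const]
  change _ - _ * expec n (monoInd (edgesIn a)) - _ * expec n (monoInd (edgesIn b)) + _ = _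
  ring

lemma monoInd_mul_monoInd {n : ℕ} {U V : Finset (EdgeOf n)} [DecidableEq (EdgeOf n)]
    (h : (U ∩ V).Nonempty) (c : EdgeColoring n) :
    monoInd U c * monoInd V c = monoInd (U ∪ V) c := by
  have : (∃ b : Bool, ∀ e ∈ U ∪ V, c e = b)
      ↔ (∃ b : Bool, ∀ e ∈ U, c e = b) ∧ ∃ b : Bool, ∀ e ∈ V, c e = b := by
    obtain ⟨e₀, he₀⟩ := h
    rw [mem_inter] at he₀
    constructor
    · rintro ⟨b, hb⟩
      exact ⟨⟨b, fun e he => hb e (mem_union_left _ he)⟩,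
        ⟨b, fun e he => hb e (mem_union_right _ he)⟩⟩
    · rintro ⟨⟨b, hb⟩, ⟨b', hb'⟩⟩
      have hbb : b = b' := (hb e₀ he₀.1).symm.trans (hb' e₀ he₀.2)
      subst hbb
      exact ⟨b, fun e he => (mem_union.1 he).elim (hb e) (hb' e)⟩
  simp only [monoInd, this]
  by_cases hU : ∃ b : Bool, ∀ e ∈ U, c e = b <;> by_cases hV : ∃ b : Bool, ∀ e ∈ V, c e = b <;>
    simp only [hU, hV, if_true, if_false, and_self, and_true, and_false, mul_one, mul_zero]

lemma cliqueCov_eq {n k : ℕ} {a b : Finset (Fin n)} (ha : #a = k) (hb : #b = k)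
    (h : 2 ≤ #(a ∩ b)) :
    cliqueCov a b = (2 ^ (#(a ∩ b)).choose 2 * 2 - 4) / 4 ^ k.choose 2 := by
  have hne : (edgesIn a ∩ edgesIn b).Nonempty := by
    rw [edgesIn_inter, ← card_pos, card_edgesIn]
    exact Nat.choose_pos h
  have hU := card_union_add_card_inter (edgesIn a) (edgesIn b)
  rw [edgesIn_inter, card_edgesIn, card_edgesIn, card_edgesIn, ha, hb] at hU
  have hpow : (2 : ℝ) ^ #(edgesIn a ∪ edgesIn b) * 2 ^ (#(a ∩ b)).choose 2
      = 4 ^ k.choose 2 := by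
    rw [← pow_add, hU, ← two_mul, pow_mul]
    norm_num
  have h4 : (2 : ℝ) ^ k.choose 2 * 2 ^ k.choose 2 = 4 ^ k.choose 2 := by
    rw [← mul_pow]
    norm_num
  simp only [cliqueCov_eq_sub, monoInd_mul_monoInd hne]
  change expec n (monoInd (edgesIn a ∪ edgesIn b)) - _ = _
  rw [expec_monoInd (hne.mono (inter_subset_left.trans subset_union_left)),
    expec_monoInd (hne.mono inter_subset_left), expec_monoInd (hne.mono inter_subset_right),
    card_edgesIn, card_edgesIn, ha, hb, div_mul_div_comm, h4, sub_div, ← hpow]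
  field_simp
  ring

lemma cliqueCov_nonneg {n k : ℕ} (hk : 2 ≤ k) {a b : Finset (Fin n)} (ha : #a = k)
    (hb : #b = k) : 0 ≤ cliqueCov a b := by
  by_cases h : #(a ∩ b) ≤ 2
  · rw [cliqueCov_eq_zero (by omega) h]
  · rw [cliqueCov_eq ha hb (by omega)]
    have : (2 : ℝ) ^ 1 ≤ 2 ^ (#(a ∩ b)).choose 2 :=
      pow_le_pow_right₀ (by norm_num) (Nat.choose_pos (by omega))
    exact div_nonneg (by linarith) (by positivity)

lemma le_cliqueCov {n k : ℕ} {a b : Finset (Fin n)} (ha : #a = k) (hb : #b = k)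
    (h : 3 ≤ #(a ∩ b)) : 1 / 4 ^ k.choose 2 ≤ cliqueCov a b := by
  rw [cliqueCov_eq ha hb (by omega)]
  have : (2 : ℝ) ^ 3 ≤ 2 ^ (#(a ∩ b)).choose 2 :=
    pow_le_pow_right₀ (by norm_num) (Nat.choose_le_choose 2 h)
  gcongr
  linarith

lemma choose_le_card_filter_superset {n k : ℕ} (hk : 3 ≤ k) {t : Finset (Fin n)} (ht : #t = 3) :
    (n - 3).choose (k - 3) ≤ #{a ∈ (univ : Finset (Fin n)).powersetCard k | t ⊆ a} := by
  have hcard : #(tᶜ.powersetCard (k - 3)) = (n - 3).choose (k - 3) := by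
    rw [card_powersetCard, card_compl, ht, Fintype.card_fin]
  rw [← hcard]
  refine card_le_card_of_injOn (fun s => s ∪ t) (fun s hs => ?_) fun s hs s' hs' h => ?_
  · have hs := mem_powersetCard.1 (mem_coe.1 hs)
    have hd : Disjoint s t := disjoint_of_subset_left hs.1 disjoint_compl_left
    simp only [coe_filter, Set.mem_ofPred_eq, mem_powersetCard]
    refine ⟨⟨subset_univ _, ?_⟩, subset_union_right⟩
    rw [card_union_of_disjoint hd, hs.2, ht]
    omega
  · have hd : ∀ s ∈ (tᶜ.powersetCard (k - 3) : Set (Finset (Fin n))), (s ∪ t) \ t = s :=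
      fun s hs => union_sdiff_cancel_right
        (disjoint_of_subset_left (mem_powersetCard.1 (mem_coe.1 hs)).1 disjoint_compl_left)
    rw [← hd s hs, ← hd s' hs', show s ∪ t = s' ∪ t from h]

lemma choose_mul_sq_le_card_pairs {n k : ℕ} (hk : 3 ≤ k) :
    n.choose 3 * (n - 3).choose (k - 3) ^ 2
      ≤ k.choose 3 * #{p ∈ (univ : Finset (Fin n)).powersetCard k ×ˢ univ.powersetCard k |
        3 ≤ #(p.1 ∩ p.2)} := by
  set P : Finset (Finset (Fin n) × Finset (Fin n)) :=
    univ.powersetCard k ×ˢ univ.powersetCard k with hP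
  set Q := {p ∈ P | 3 ≤ #(p.1 ∩ p.2)} with hQ
  have h1 : n.choose 3 * (n - 3).choose (k - 3) ^ 2
      ≤ ∑ t ∈ (univ : Finset (Fin n)).powersetCard 3, #{p ∈ Q | t ⊆ p.1 ∩ p.2} := by
    have : n.choose 3 * (n - 3).choose (k - 3) ^ 2
        = ∑ t ∈ (univ : Finset (Fin n)).powersetCard 3, (n - 3).choose (k - 3) ^ 2 := by
      rw [sum_const, card_powersetCard, card_univ, Fintype.card_fin, smul_eq_mul]
    rw [this]
    refine sum_le_sum fun t ht => ?_
    have ht3 := (mem_powersetCard.1 ht).2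
    calc (n - 3).choose (k - 3) ^ 2
        ≤ #{a ∈ (univ : Finset (Fin n)).powersetCard k | t ⊆ a} ^ 2 :=
          Nat.pow_le_pow_left (choose_le_card_filter_superset hk ht3) 2
      _ = #({a ∈ (univ : Finset (Fin n)).powersetCard k | t ⊆ a}
            ×ˢ {a ∈ (univ : Finset (Fin n)).powersetCard k | t ⊆ a}) := by
          rw [card_product, sq]
      _ ≤ #{p ∈ Q | t ⊆ p.1 ∩ p.2} := by
          refine card_le_card fun p hp => ?_
          simp only [mem_product, mem_filter] at hp
          have hsub := subset_inter hp.1.2 hp.2.2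
          simp only [hQ, hP, mem_filter, mem_product]
          exact ⟨⟨⟨hp.1.1, hp.2.1⟩, ht3.symm.trans_le (card_le_card hsub)⟩, hsub⟩
  refine h1.trans ?_
  have hcount := sum_card_bipartiteAbove_eq_sum_card_bipartiteBelow
    (s := (univ : Finset (Fin n)).powersetCard 3) (t := Q) (fun t p => t ⊆ p.1 ∩ p.2)
  simp only [bipartiteAbove, bipartiteBelow] at hcount
  rw [hcount, mul_comm, ← smul_eq_mul]
  refine sum_le_card_nsmul _ _ _ fun p hp => ?_
  have hp' := (mem_powersetCard.1 (mem_product.1 (mem_filter.1 hp).1).1).2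
  rw [← hp', ← card_powersetCard]
  refine card_le_card fun t ht => ?_
  have ht := mem_filter.1 ht
  exact mem_powersetCard.2 ⟨ht.2.trans inter_subset_left, (mem_powersetCard.1 ht.1).2⟩

lemma exists_pow_le_choose (r m : ℕ) :
    ∃ c : ℝ, 0 < c ∧ ∀ᶠ n : ℕ in Filter.atTop, c * (n : ℝ) ^ r ≤ ((n - m).choose r : ℝ) := by
  refine ⟨1 / (2 ^ r * r.factorial), by positivity, ?_⟩
  filter_upwards [Filter.eventually_ge_atTop (2 * (m + r))] with n hn
  have h1 := Nat.pow_le_choose r (n - m) (α := ℝ)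
  have h2 : (n : ℝ) / 2 ≤ ((n - m + 1 - r : ℕ) : ℝ) := by
    have : n ≤ 2 * (n - m + 1 - r) := by omega
    have : (n : ℝ) ≤ 2 * ((n - m + 1 - r : ℕ) : ℝ) := by exact_mod_cast this
    linarith
  refine le_trans (le_of_eq ?_) ((div_le_div_of_nonneg_right
    (pow_le_pow_left₀ (by positivity) h2 r) (by positivity)).trans h1)
  rw [div_pow]
  field_simp

lemma exists_pow_le_centralMoment_two {k : ℕ} (hk : 3 ≤ k) :
    ∃ c : ℝ, 0 < c ∧ ∀ᶠ n : ℕ in Filter.atTop, c * (n : ℝ) ^ (2 * k - 3) ≤ centralMoment n k 2 := by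
  obtain ⟨c₁, hc₁, h1⟩ := exists_pow_le_choose 3 0
  obtain ⟨c₂, hc₂, h2⟩ := exists_pow_le_choose (k - 3) 3
  have hk0 : (0 : ℝ) < k.choose 3 := by exact_mod_cast Nat.choose_pos hk
  refine ⟨c₁ * c₂ ^ 2 / k.choose 3 * (1 / 4 ^ k.choose 2), by positivity, ?_⟩
  filter_upwards [h1, h2] with n h1 h2
  set P : Finset (Finset (Fin n) × Finset (Fin n)) :=
    univ.powersetCard k ×ˢ univ.powersetCard k with hP
  have hV : (#{p ∈ P | 3 ≤ #(p.1 ∩ p.2)} : ℝ) * (1 / 4 ^ k.choose 2) ≤ centralMoment n k 2 := by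
    have hVP : centralMoment n k 2 = ∑ p ∈ P, cliqueCov p.1 p.2 := by
      rw [centralMoment_two_eq_sum, hP, sum_product]
    have hmem : ∀ p ∈ P, #p.1 = k ∧ #p.2 = k := fun p hp =>
      ⟨(mem_powersetCard.1 (mem_product.1 hp).1).2, (mem_powersetCard.1 (mem_product.1 hp).2).2⟩
    calc (#{p ∈ P | 3 ≤ #(p.1 ∩ p.2)} : ℝ) * (1 / 4 ^ k.choose 2)
        = ∑ p ∈ P with 3 ≤ #(p.1 ∩ p.2), (1 / 4 ^ k.choose 2 : ℝ) := by
          rw [sum_const, nsmul_eq_mul]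
      _ ≤ ∑ p ∈ P with 3 ≤ #(p.1 ∩ p.2), cliqueCov p.1 p.2 := by
          refine sum_le_sum fun p hp => ?_
          obtain ⟨hp, h3⟩ := mem_filter.1 hp
          exact le_cliqueCov (hmem p hp).1 (hmem p hp).2 h3
      _ ≤ ∑ p ∈ P, cliqueCov p.1 p.2 :=
          sum_le_sum_of_subset_of_nonneg (filter_subset _ _) fun p hp _ =>
            cliqueCov_nonneg (by omega) (hmem p hp).1 (hmem p hp).2
      _ = centralMoment n k 2 := hVP.symm
  have hQ : (n.choose 3 : ℝ) * ((n - 3).choose (k - 3) : ℝ) ^ 2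
      ≤ k.choose 3 * (#{p ∈ P | 3 ≤ #(p.1 ∩ p.2)} : ℝ) := by
    exact_mod_cast choose_mul_sq_le_card_pairs hk
  have hprod : c₁ * (n : ℝ) ^ 3 * (c₂ * (n : ℝ) ^ (k - 3)) ^ 2
      ≤ (n.choose 3 : ℝ) * ((n - 3).choose (k - 3) : ℝ) ^ 2 := by
    rw [Nat.sub_zero] at h1
    gcongr
  refine le_trans ?_ hV
  rw [mul_right_comm]
  refine mul_le_mul_of_nonneg_right ?_ (by positivity)
  rw [div_mul_eq_mul_div, div_le_iff₀ hk0, mul_comm _ (k.choose 3 : ℝ)]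
  refine le_trans (le_of_eq ?_) (hprod.trans hQ)
  rw [show 2 * k - 3 = 3 + (k - 3) * 2 by omega, pow_add, pow_mul]
  ring

/-! ### Asymptotics -/

lemma tendsto_div_rpow_zero {A V : ℕ → ℝ} {C c : ℝ} {a b : ℕ} {s : ℝ} (hc : 0 < c) (hs : 0 ≤ s)
    (hA : ∀ᶠ n : ℕ in Filter.atTop, |A n| ≤ C * (n : ℝ) ^ a)
    (hV : ∀ᶠ n : ℕ in Filter.atTop, c * (n : ℝ) ^ b ≤ V n) (hab : (a : ℝ) < b * s) :
    Filter.Tendsto (fun n => A n / V n ^ s) Filter.atTop (nhds 0) := by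
  have hlim : Filter.Tendsto (fun n : ℕ => C / c ^ s * (n : ℝ) ^ (-(b * s - a)))
      Filter.atTop (nhds 0) := by
    simpa using ((tendsto_rpow_neg_atTop (sub_pos.2 hab)).comp
      tendsto_natCast_atTop_atTop).const_mul (C / c ^ s)
  refine squeeze_zero_norm' ?_ hlim
  filter_upwards [hA, hV, Filter.eventually_gt_atTop 0] with n hA hV hn
  have hn' : (0 : ℝ) < n := by exact_mod_cast hn
  have hpos : 0 < c * (n : ℝ) ^ b := by positivity
  have hVs : (c * (n : ℝ) ^ b) ^ s ≤ V n ^ s := Real.rpow_le_rpow hpos.le hV hs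
  rw [Real.norm_eq_abs, abs_div, abs_of_pos (Real.rpow_pos_of_pos (hpos.trans_le hV) s)]
  calc |A n| / V n ^ s ≤ C * (n : ℝ) ^ a / (c * (n : ℝ) ^ b) ^ s := by
        gcongr
        exact (abs_nonneg _).trans hA
    _ = C / c ^ s * (n : ℝ) ^ (-(b * s - a)) := by
        rw [Real.mul_rpow hc.le (by positivity), ← Real.rpow_natCast_mul hn'.le,
          neg_sub, Real.rpow_sub hn', Real.rpow_natCast]
        ring

theorem standardized_moments_normal (k : ℕ) (hk : 3 ≤ k) :
    Filter.Tendsto (fun n : ℕ =>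
      centralMoment n k 3 / centralMoment n k 2 ^ ((3 : ℝ) / 2))
      Filter.atTop (nhds 0) ∧
    Filter.Tendsto (fun n : ℕ =>
      centralMoment n k 4 / centralMoment n k 2 ^ 2)
      Filter.atTop (nhds 3) ∧
    Filter.Tendsto (fun n : ℕ =>
      centralMoment n k 5 / centralMoment n k 2 ^ ((5 : ℝ) / 2))
      Filter.atTop (nhds 0) := by
  obtain ⟨c, hc, hV⟩ := exists_pow_le_centralMoment_two hk
  have hk2 : 2 ≤ k := by omega
  have hk' : (3 : ℝ) ≤ k := by exact_mod_cast hk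
  refine ⟨?_, ?_, ?_⟩
  · refine tendsto_div_rpow_zero (C := 2 ^ ((3 * k - 5) * 3)) (a := 3 * k - 5) hc
      (by norm_num) ?_ hV ?_
    · exact (Filter.eventually_ge_atTop (3 * k - 5)).mono fun n hn =>
        abs_centralMoment_le hk2 hn (by omega)
    · rw [Nat.cast_sub (by omega), Nat.cast_sub (by omega)]
      push_cast
      linarith
  · have h : Filter.Tendsto (fun n : ℕ =>
        (centralMoment n k 4 - 3 * centralMoment n k 2 ^ 2) / centralMoment n k 2 ^ (2 : ℝ))
        Filter.atTop (nhds 0) := by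
      refine tendsto_div_rpow_zero (C := 4 * 2 ^ ((4 * k - 7) * 4)) (a := 4 * k - 7) hc
        (by norm_num) ?_ hV ?_
      · exact (Filter.eventually_ge_atTop (4 * k - 7)).mono fun n hn =>
          abs_centralMoment_four_sub_le hk2 hn
      · rw [Nat.cast_sub (by omega), Nat.cast_sub (by omega)]
        push_cast
        linarith
    have h3 := h.add_const 3
    rw [zero_add] at h3
    refine h3.congr' ?_
    filter_upwards [hV, Filter.eventually_gt_atTop 0] with n hV hn
    have hpos : 0 < centralMoment n k 2 := by
      have : (0 : ℝ) < n := by exact_mod_cast hn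
      exact lt_of_lt_of_le (by positivity) hV
    rw [Real.rpow_two]
    field_simp
    ring
  · refine tendsto_div_rpow_zero (C := 2 ^ ((5 * k - 8) * 5)) (a := 5 * k - 8) hc
      (by norm_num) ?_ hV ?_
    · exact (Filter.eventually_ge_atTop (5 * k - 8)).mono fun n hn =>
        abs_centralMoment_le hk2 hn (by omega)
    · rw [Nat.cast_sub (by omega), Nat.cast_sub (by omega)]
      push_cast
      linarith
end
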